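/- arXiv:math/0607805 — 2 statements merged into one kernel-verified Lean document; each statement's English description precedes it below -/
import Mathlib

section
/- Let d ≥ 2 and 0 < α < d, and let P be a simple point process on ℝ^d satisfying Assumptions (A1) and (A2). Then: (a) there exists c > 0 such that, P-a.s. for all sufficiently large L, the spectral profile of model 1 satisfies Λ¹(r) ≥ c·ψ_L(r)² for all r ∈ [ν¹_*, 1); and (b) there exists C < ∞ such that, P-a.s. for all sufficiently large L, the Poincaré constant of model 1 satisfies γ¹(L) ≤ C·L². -/
open MeasureTheory Filter
open scoped ENNReal

noncomputable section

abbrev Pt (d : ℕ) := EuclideanSpace ℝ (Fin d)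
abbrev Config (d : ℕ) := Set (Pt d)

def IsLocallyFinite {d : ℕ} (ξ : Config d) : Prop :=
  ∀ A : Set (Pt d), Bornology.IsBounded A → (ξ ∩ A).Finite

instance configMS (d : ℕ) : MeasurableSpace (Config d) :=
  MeasurableSpace.generateFrom
    { E | ∃ (A : Set (Pt d)) (n : ℕ), Bornology.IsBounded A ∧ MeasurableSet A ∧
        E = {ξ : Config d | (ξ ∩ A).ncard = n} }

def IsPointProcess {d : ℕ} (P : Measure (Config d)) : Prop :=
  IsProbabilityMeasure P ∧ ∀ᵐ ξ ∂P, IsLocallyFinite ξ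

def cube (d : ℕ) (L : ℝ) : Set (Pt d) := {p | ∀ i, |p i| ≤ L / 2}

/-- The cube `B_x = Kx + [0,K)^d`. -/
def Kcube (d : ℕ) (K : ℝ) (x : Fin d → ℤ) : Set (Pt d) :=
  {p | ∀ i, K * x i ≤ p i ∧ p i < K * x i + K}

/-- Bernoulli(p) i.i.d. field on `ℤ^d`, characterized by its cylinder probabilities. -/
def IsBernoulliField (d : ℕ) (p : ℝ) (ν : Measure ((Fin d → ℤ) → Bool)) : Prop :=
  IsProbabilityMeasure ν ∧
  ∀ (S : Finset (Fin d → ℤ)) (b : (Fin d → ℤ) → Bool),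
    ν {ω | ∀ x ∈ S, ω x = b x} = ∏ x ∈ S, ENNReal.ofReal (if b x then p else 1 - p)

/-- Assumption (A1): for every p < 1 there is K such that the good-box field
dominates an i.i.d. Bernoulli(p) field, in the sense of a monotone coupling. -/
def AssumptionA1 {d : ℕ} (P : Measure (Config d)) : Prop :=
  ∀ p : ℝ, 0 < p → p < 1 → ∃ K : ℝ, 0 < K ∧
    ∃ (μ : Measure (Config d × ((Fin d → ℤ) → Bool))) (ν : Measure ((Fin d → ℤ) → Bool)),
      IsProbabilityMeasure μ ∧ IsBernoulliField d p ν ∧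
      μ.map Prod.fst = P ∧ μ.map Prod.snd = ν ∧
      ∀ᵐ ω ∂μ, ∀ x : Fin d → ℤ, ω.2 x = true → (ω.1 ∩ Kcube d K x).Nonempty

/-- `R_A(ξ) = Σ_{x ∈ ξ∩A} Σ_{y ∈ ξ} exp(-|x-y|^α)` (valued in `ℝ≥0∞`). -/
def Rfun {d : ℕ} (α : ℝ) (A : Set (Pt d)) (ξ : Config d) : ℝ≥0∞ :=
  ∑' (x : ↥(ξ ∩ A)) (y : ↥ξ), ENNReal.ofReal (Real.exp (-(dist (x : Pt d) (y : Pt d)) ^ α))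

/-- The cube `V_x = L^ε x + [0, L^ε)^d`. -/
def Vcube (d : ℕ) (L : ℕ) (ε : ℝ) (x : Fin d → ℤ) : Set (Pt d) :=
  {p | ∀ i, (L : ℝ) ^ ε * x i ≤ p i ∧ p i < (L : ℝ) ^ ε * x i + (L : ℝ) ^ ε}

/-- Assumption (A2). -/
def AssumptionA2 {d : ℕ} (α : ℝ) (P : Measure (Config d)) : Prop :=
  ∀ ε : ℝ, 0 < ε → ε < 1 → ∃ C : ℝ, 0 < C ∧
    ∀ᵐ ξ ∂P, ∀ᶠ L : ℕ in atTop,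
      ∀ x : Fin d → ℤ, (Vcube d L ε x ∩ cube d L).Nonempty →
        Rfun α (Vcube d L ε x) ξ ≤ ENNReal.ofReal (C * (L : ℝ) ^ (ε * d))

noncomputable instance {d : ℕ} : DecidableEq (Pt d) := Classical.decEq _

variable {d : ℕ}

/-- jump rate `e^{-|x-y|^α}`. -/
def rate (α : ℝ) (x y : Pt d) : ℝ := Real.exp (-(dist x y) ^ α)

/-- weights `w^i_x` for the three models `i = 1,2,3`. -/
def wgt (α : ℝ) (E : Finset (Pt d)) (i : ℕ) (x : Pt d) : ℝ :=
  if i = 1 then 1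
  else if i = 2 then ∑ z ∈ E.erase x, rate α x z
  else max 1 (∑ z ∈ E.erase x, rate α x z)

/-- `W^i(U) = Σ_{x∈U} w^i_x`. -/
def Wsum (α : ℝ) (E : Finset (Pt d)) (i : ℕ) (U : Finset (Pt d)) : ℝ :=
  ∑ x ∈ U, wgt α E i x

/-- the reversible probability measure `ν^i(x) = w^i_x / W^i(ξ_L)`. -/
def nu (α : ℝ) (E : Finset (Pt d)) (i : ℕ) (x : Pt d) : ℝ :=
  wgt α E i x / Wsum α E i E

/-- conductance `I^i_U`. -/
def conduct (α : ℝ) (E : Finset (Pt d)) (i : ℕ) (U : Finset (Pt d)) : ℝ :=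
  (∑ x ∈ U, ∑ y ∈ E \ U, rate α x y) / Wsum α E i U

/-- isoperimetric profile `φ^i_L(t)` (valued in `ℝ≥0∞`; `∞` if no admissible `U`). -/
def isoProfile (α : ℝ) (E : Finset (Pt d)) (i : ℕ) (t : ℝ) : ℝ≥0∞ :=
  ⨅ (U : Finset (Pt d)) (_ : U ⊆ E) (_ : U.Nonempty)
    (_ : Wsum α E i U ≤ t * Wsum α E i E), ENNReal.ofReal (conduct α E i U)

/-- Cheeger's constant `Φ^i_L = φ^i_L(1/2)`. -/
def cheeger (α : ℝ) (E : Finset (Pt d)) (i : ℕ) : ℝ≥0∞ := isoProfile α E i (1 / 2)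

/-- Dirichlet form `E_i(f)`. -/
def dirichlet (α : ℝ) (E : Finset (Pt d)) (i : ℕ) (f : Pt d → ℝ) : ℝ :=
  (1 / 2) * ∑ x ∈ E, ∑ y ∈ E.erase x,
    nu α E i x * (rate α x y / wgt α E i x) * (f x - f y) ^ 2

/-- variance `Var_i(f) = ν^i(f²) - ν^i(f)²`. -/
def varNu (α : ℝ) (E : Finset (Pt d)) (i : ℕ) (f : Pt d → ℝ) : ℝ :=
  (∑ x ∈ E, nu α E i x * f x ^ 2) - (∑ x ∈ E, nu α E i x * f x) ^ 2

/-- nonconstant on `E`. -/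
def Nonconst (E : Finset (Pt d)) (f : Pt d → ℝ) : Prop := ∃ x ∈ E, ∃ y ∈ E, f x ≠ f y

/-- Poincaré constant `γ^i(L) = sup { Var_i f / E_i f : f nonconstant }`. -/
def gammaP (α : ℝ) (E : Finset (Pt d)) (i : ℕ) : ℝ≥0∞ :=
  ⨆ (f : Pt d → ℝ) (_ : Nonconst E f),
    ENNReal.ofReal (varNu α E i f / dirichlet α E i f)

/-- the generator `L^i` as a matrix on `E`. -/
def gen (α : ℝ) (E : Finset (Pt d)) (i : ℕ) : Matrix ↥E ↥E ℝ :=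
  Matrix.of fun x y =>
    if x = y then -(∑ z ∈ E.erase (x : Pt d), rate α (x : Pt d) z / wgt α E i (x : Pt d))
    else rate α (x : Pt d) (y : Pt d) / wgt α E i (x : Pt d)

/-- heat kernel `H^i_t = exp(t L^i)`, via the exponential series. -/
def heatKernel (α : ℝ) (E : Finset (Pt d)) (i : ℕ) (t : ℝ) (x y : ↥E) : ℝ :=
  ∑' n : ℕ, t ^ n / (n.factorial : ℝ) * (gen α E i ^ n) x y

/-- uniform mixing time `τ^i(L)` (valued in `ℝ≥0∞`). -/
def mixTime (α : ℝ) (E : Finset (Pt d)) (i : ℕ) : ℝ≥0∞ :=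
  ⨅ (t : ℝ) (_ : 0 < t)
    (_ : ∀ x y : ↥E,
      |heatKernel α E i t x y - nu α E i (y : Pt d)| / nu α E i (y : Pt d) ≤ Real.exp (-1)),
    ENNReal.ofReal t

/-- `c₀⁺(U)`: nonnegative, nonconstant, vanishing outside `U`. -/
def c0plus (E U : Finset (Pt d)) (f : Pt d → ℝ) : Prop :=
  (∀ x ∈ E, 0 ≤ f x) ∧ Nonconst E f ∧ ∀ x ∈ E, x ∉ U → f x = 0

/-- `λ^i(U) = inf { E_i f / Var_i f : f ∈ c₀⁺(U) }`. -/
def lambdaU (α : ℝ) (E : Finset (Pt d)) (i : ℕ) (U : Finset (Pt d)) : ℝ :=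
  sInf {r : ℝ | ∃ f : Pt d → ℝ, c0plus E U f ∧ r = dirichlet α E i f / varNu α E i f}

/-- `ν^i_* = min_{x∈E} ν^i(x)`. -/
def nuStar (α : ℝ) (E : Finset (Pt d)) (i : ℕ) : ℝ :=
  sInf (nu α E i '' ↑E)

/-- `ν^i(U)` for a subset `U`. -/
def nuSet (α : ℝ) (E : Finset (Pt d)) (i : ℕ) (U : Finset (Pt d)) : ℝ :=
  ∑ x ∈ U, nu α E i x

/-- spectral profile `Λ^i(r)`. -/
def specProfile (α : ℝ) (E : Finset (Pt d)) (i : ℕ) (r : ℝ) : ℝ :=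
  sInf {l : ℝ | ∃ U : Finset (Pt d), U ⊆ E ∧
    nuStar α E i ≤ nuSet α E i U ∧ nuSet α E i U ≤ r ∧ l = lambdaU α E i U}

/-- hybrid conductance profile `ψ_L(t)`: model-3 conductance, counting constraint. -/
def hybridProfile (α : ℝ) (E : Finset (Pt d)) (t : ℝ) : ℝ≥0∞ :=
  ⨅ (U : Finset (Pt d)) (_ : U ⊆ E) (_ : U.Nonempty)
    (_ : (U.card : ℝ) ≤ t * (E.card : ℝ)), ENNReal.ofReal (conduct α E 3 U)

/-! ### The Cheeger-type bound for the spectral profile -/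

lemma rate_comm (α : ℝ) (x y : Pt d) : rate α x y = rate α y x := by
  simp [rate, dist_comm]

lemma rate_pos (α : ℝ) (x y : Pt d) : 0 < rate α x y := Real.exp_pos _

/-- The unnormalized energy `∑ rate(x,y) (f x - f y)²` over ordered pairs. -/
def energy (α : ℝ) (E : Finset (Pt d)) (f : Pt d → ℝ) : ℝ :=
  ∑ x ∈ E, ∑ y ∈ E, rate α x y * (f x - f y) ^ 2

lemma energy_nonneg (α : ℝ) (E : Finset (Pt d)) (f : Pt d → ℝ) : 0 ≤ energy α E f :=
  Finset.sum_nonneg fun x _ => Finset.sum_nonneg fun y _ =>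
    mul_nonneg (rate_pos α x y).le (sq_nonneg _)

lemma nu_one (α : ℝ) (E : Finset (Pt d)) (x : Pt d) : nu α E 1 x = (E.card : ℝ)⁻¹ := by
  simp [nu, wgt, Wsum]

lemma dirichlet_one (α : ℝ) (E : Finset (Pt d)) (f : Pt d → ℝ) :
    dirichlet α E 1 f = energy α E f / (2 * E.card) := by
  have h : ∀ x ∈ E, ∑ y ∈ E.erase x, nu α E 1 x * (rate α x y / wgt α E 1 x) * (f x - f y) ^ 2
      = (E.card : ℝ)⁻¹ * ∑ y ∈ E, rate α x y * (f x - f y) ^ 2 := by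
    intro x hx
    rw [← Finset.add_sum_erase E _ hx, mul_add, Finset.mul_sum]
    simp [nu_one, wgt, mul_assoc]
  rw [dirichlet, Finset.sum_congr rfl h, ← Finset.mul_sum, energy]
  rw [mul_comm (2 : ℝ), div_mul_eq_div_div]
  ring

lemma sum_sub_const_sq {ι : Type*} (E : Finset ι) (f : ι → ℝ) (m : ℝ) :
    ∑ x ∈ E, (f x - m) ^ 2 = ∑ x ∈ E, f x ^ 2 - 2 * m * ∑ x ∈ E, f x + E.card * m ^ 2 := by
  simp only [sub_sq, Finset.sum_add_distrib, Finset.sum_sub_distrib, Finset.sum_const,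
    nsmul_eq_mul, Finset.mul_sum]
  congr 2
  exact Finset.sum_congr rfl fun x _ => by ring

lemma varNu_one (α : ℝ) (E : Finset (Pt d)) (f : Pt d → ℝ) :
    varNu α E 1 f = (E.card : ℝ)⁻¹ * ∑ x ∈ E, f x ^ 2 - ((E.card : ℝ)⁻¹ * ∑ x ∈ E, f x) ^ 2 := by
  simp [varNu, nu_one, Finset.mul_sum]

lemma varNu_one_eq (α : ℝ) {E : Finset (Pt d)} (hE : E.Nonempty) (f : Pt d → ℝ) :
    varNu α E 1 f
      = (E.card : ℝ)⁻¹ * ∑ x ∈ E, (f x - (E.card : ℝ)⁻¹ * ∑ y ∈ E, f y) ^ 2 := by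
  have : (E.card : ℝ) ≠ 0 := by exact_mod_cast hE.card_pos.ne'
  rw [varNu_one, sum_sub_const_sq]
  field_simp
  ring

lemma varNu_one_le (α : ℝ) {E : Finset (Pt d)} (hE : E.Nonempty) (f : Pt d → ℝ) (m : ℝ) :
    varNu α E 1 f ≤ (E.card : ℝ)⁻¹ * ∑ x ∈ E, (f x - m) ^ 2 := by
  have hc : (E.card : ℝ) ≠ 0 := by exact_mod_cast hE.card_pos.ne'
  have h : (E.card : ℝ)⁻¹ * ∑ x ∈ E, (f x - m) ^ 2 - varNu α E 1 f
      = (m - (E.card : ℝ)⁻¹ * ∑ y ∈ E, f y) ^ 2 := by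
    rw [varNu_one, sum_sub_const_sq]
    field_simp
    ring
  nlinarith [sq_nonneg (m - (E.card : ℝ)⁻¹ * ∑ y ∈ E, f y)]

lemma varNu_one_pos (α : ℝ) {E : Finset (Pt d)} {f : Pt d → ℝ} (hf : Nonconst E f) :
    0 < varNu α E 1 f := by
  obtain ⟨x, hx, y, hy, hxy⟩ := hf
  have hE : E.Nonempty := ⟨x, hx⟩
  rw [varNu_one_eq α hE]
  have hc : (0 : ℝ) < (E.card : ℝ)⁻¹ := by
    have := hE.card_pos
    positivity
  refine mul_pos hc ?_
  set m := (E.card : ℝ)⁻¹ * ∑ y ∈ E, f y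
  refine Finset.sum_pos' (fun _ _ => sq_nonneg _) ?_
  by_cases h : f x = m
  · exact ⟨y, hy, sq_pos_of_ne_zero fun h' => hxy (h.trans (sub_eq_zero.1 h').symm)⟩
  · exact ⟨x, hx, sq_pos_of_ne_zero fun h' => h (sub_eq_zero.1 h')⟩

lemma one_le_wgt_three (α : ℝ) (E : Finset (Pt d)) (x : Pt d) : 1 ≤ wgt α E 3 x := by
  simp [wgt]

lemma sum_rate_le_wgt_three (α : ℝ) (E : Finset (Pt d)) (x : Pt d) :
    ∑ z ∈ E.erase x, rate α x z ≤ wgt α E 3 x := by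
  simp [wgt]

lemma Wsum_three_pos (α : ℝ) (E : Finset (Pt d)) {U : Finset (Pt d)} (hU : U.Nonempty) :
    0 < Wsum α E 3 U :=
  Finset.sum_pos (fun x _ => zero_lt_one.trans_le (one_le_wgt_three α E x)) hU

lemma conduct_three_nonneg (α : ℝ) (E U : Finset (Pt d)) : 0 ≤ conduct α E 3 U :=
  div_nonneg (Finset.sum_nonneg fun x _ => Finset.sum_nonneg fun y _ => (rate_pos α x y).le)
    (Finset.sum_nonneg fun x _ => zero_le_one.trans (one_le_wgt_three α E x))

/-- Discrete co-area inequality: a lower bound on the boundary of all subsets of `U` gives a lower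
bound on the total positive variation of functions supported in `U`. -/
lemma coarea {ι : Type*} [DecidableEq ι] (E : Finset ι) (k : ι → ι → ℝ) (w : ι → ℝ) (q : ℝ)
    (U : Finset ι) (hq : ∀ V ⊆ U, V.Nonempty → q * ∑ x ∈ V, w x ≤ ∑ x ∈ V, ∑ y ∈ E \ V, k x y)
    (h : ι → ℝ) (h0 : ∀ x ∈ E, 0 ≤ h x) (hU : ∀ x ∈ E, x ∉ U → h x = 0) :
    q * ∑ x ∈ E, w x * h x ≤ ∑ x ∈ E, ∑ y ∈ E, k x y * max (h x - h y) 0 := by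
  induction' hn : (E.filter fun x => h x ≠ 0).card using Nat.strong_induction_on
    with n ih generalizing h
  set V := E.filter fun x => h x ≠ 0 with hV
  have hVE : V ⊆ E := Finset.filter_subset _ _
  have hVU : V ⊆ U := by
    intro x hx
    by_contra hxU
    rw [hV, Finset.mem_filter] at hx
    exact hx.2 (hU x hx.1 hxU)
  rcases V.eq_empty_or_nonempty with hVe | hVn
  · have hz : ∀ x ∈ E, h x = 0 := by
      intro x hx
      by_contra hne
      have : x ∈ V := Finset.mem_filter.2 ⟨hx, hne⟩
      simp [hVe] at this
    rw [Finset.sum_eq_zero fun x hx => by rw [hz x hx, mul_zero],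
      Finset.sum_eq_zero fun x hx => Finset.sum_eq_zero fun y hy => by simp [hz x hx, hz y hy]]
    simp
  · obtain ⟨z, hz, hmin⟩ := V.exists_min_image h hVn
    set m := h z with hm
    have hm0 : 0 ≤ m := h0 z (hVE hz)
    set g : ι → ℝ := fun x => h x - if x ∈ V then m else 0 with hg
    have hnV : ∀ x ∈ E, x ∉ V → h x = 0 := by
      intro x hx hxV
      by_contra hne
      exact hxV (Finset.mem_filter.2 ⟨hx, hne⟩)
    have hg0 : ∀ x ∈ E, 0 ≤ g x := by
      intro x hx
      by_cases hxV : x ∈ V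
      · simpa [hg, hxV] using hmin x hxV
      · simpa [hg, hxV] using h0 x hx
    have hgV : ∀ x ∈ E, x ∉ V → g x = 0 := by
      intro x hx hxV
      simp [hg, hxV, hnV x hx hxV]
    have hlt : (E.filter fun x => g x ≠ 0).card < n := by
      rw [← hn]
      refine Finset.card_lt_card ⟨?_, ?_⟩
      · intro x hx
        rw [Finset.mem_filter] at hx
        by_contra hxV
        exact hx.2 (hgV x hx.1 hxV)
      · intro hsub
        have := hsub hz
        rw [Finset.mem_filter] at this
        exact this.2 (by simp [hg, hz, hm])
    have hrec := ih _ hlt g hg0 (fun x hx hxU => hgV x hx fun hxV => hxU (hVU hxV)) rfl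
    have h1 : ∑ x ∈ E, w x * h x = ∑ x ∈ E, w x * g x + m * ∑ x ∈ V, w x := by
      have : ∑ x ∈ V, w x = ∑ x ∈ E, if x ∈ V then w x else 0 := by
        rw [← Finset.sum_filter, Finset.filter_mem_eq_inter, Finset.inter_eq_right.2 hVE]
      rw [this, Finset.mul_sum, ← Finset.sum_add_distrib]
      refine Finset.sum_congr rfl fun x _ => ?_
      by_cases hxV : x ∈ V <;> simp [hg, hxV]
      ring
    have h2 : ∑ x ∈ E, ∑ y ∈ E, k x y * max (h x - h y) 0
        = ∑ x ∈ E, ∑ y ∈ E, k x y * max (g x - g y) 0 + m * ∑ x ∈ V, ∑ y ∈ E \ V, k x y := by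
      have : ∑ x ∈ V, ∑ y ∈ E \ V, k x y
          = ∑ x ∈ E, ∑ y ∈ E, if x ∈ V ∧ y ∉ V then k x y else 0 := by
        have e1 : ∀ x ∈ E, (∑ y ∈ E, if x ∈ V ∧ y ∉ V then k x y else 0)
            = if x ∈ V then ∑ y ∈ E \ V, k x y else 0 := by
          intro x _
          by_cases hxV : x ∈ V
          · simp only [hxV, true_and, if_true]
            rw [← Finset.sum_filter, ← Finset.sdiff_eq_filter]
          · simp [hxV]
        rw [Finset.sum_congr rfl e1, ← Finset.sum_filter, Finset.filter_mem_eq_inter,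
          Finset.inter_eq_right.2 hVE]
      rw [this, Finset.mul_sum, ← Finset.sum_add_distrib]
      refine Finset.sum_congr rfl fun x hx => ?_
      rw [Finset.mul_sum, ← Finset.sum_add_distrib]
      refine Finset.sum_congr rfl fun y hy => ?_
      by_cases hxV : x ∈ V <;> by_cases hyV : y ∈ V
      · simp [hg, hxV, hyV]
      · have := hmin x hxV
        have e0 : h y = 0 := hnV y hy hyV
        simp only [hg, hxV, hyV, e0, if_true, if_false, not_false_eq_true, and_self, sub_zero]
        rw [max_eq_left (h0 x hx), max_eq_left (by linarith)]
        ring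
      · have := h0 y hy
        have := hg0 y hy
        rw [hnV x hx hxV, hgV x hx hxV, max_eq_right (by linarith), max_eq_right (by linarith)]
        simp [hxV]
      · simp [hg, hxV, hyV]
    rw [h1, h2, mul_add]
    have := mul_le_mul_of_nonneg_left (hq V hVU hVn) hm0
    linarith

/-- Cheeger-type bound: the mixed model-3 conductance controls the model-1 Dirichlet form. -/
lemma sq_mul_sum_le_energy (α : ℝ) (E U : Finset (Pt d)) (q : ℝ) (hq0 : 0 ≤ q)
    (hq : ∀ V ⊆ U, V.Nonempty → q ≤ conduct α E 3 V) (f : Pt d → ℝ)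
    (hU : ∀ x ∈ E, x ∉ U → f x = 0) :
    q ^ 2 * ∑ x ∈ E, f x ^ 2 ≤ energy α E f := by
  rcases hq0.eq_or_lt with rfl | hqpos
  · simpa using energy_nonneg α E f
  have hco := coarea E (rate α) (wgt α E 3) q U (fun V hV hVn => by
      have := hq V hV hVn
      rwa [conduct, le_div_iff₀ (Wsum_three_pos α E hVn)] at this) (fun x => f x ^ 2)
      (fun x _ => sq_nonneg _) (fun x hx hxU => by simp [hU x hx hxU])
  set W := ∑ x ∈ E, wgt α E 3 x * f x ^ 2 with hW
  set S := ∑ x ∈ E, ∑ y ∈ E, rate α x y * max (f x ^ 2 - f y ^ 2) 0 with hS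
  have hS2 : 2 * S = ∑ x ∈ E, ∑ y ∈ E, rate α x y * |f x ^ 2 - f y ^ 2| := by
    have : S = ∑ x ∈ E, ∑ y ∈ E, rate α x y * max (f y ^ 2 - f x ^ 2) 0 := by
      rw [hS, Finset.sum_comm]
      exact Finset.sum_congr rfl fun x _ => Finset.sum_congr rfl fun y _ => by rw [rate_comm]
    rw [two_mul]
    nth_rewrite 2 [this]
    rw [hS, ← Finset.sum_add_distrib]
    refine Finset.sum_congr rfl fun x _ => ?_
    rw [← Finset.sum_add_distrib]
    refine Finset.sum_congr rfl fun y _ => ?_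
    rw [← mul_add]
    congr 1
    rcases le_total (f x ^ 2) (f y ^ 2) with h | h
    · rw [max_eq_right (by linarith), max_eq_left (by linarith), abs_of_nonpos (by linarith)]
      ring
    · rw [max_eq_left (by linarith), max_eq_right (by linarith), abs_of_nonneg (by linarith)]
      ring
  have hB : ∑ x ∈ E, ∑ y ∈ E.erase x, rate α x y * (f x + f y) ^ 2 ≤ 4 * W := by
    have b1 : ∑ x ∈ E, ∑ y ∈ E.erase x, rate α x y * f x ^ 2 ≤ W := by
      refine Finset.sum_le_sum fun x _ => ?_
      rw [← Finset.sum_mul]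
      exact mul_le_mul_of_nonneg_right (sum_rate_le_wgt_three α E x) (sq_nonneg _)
    have b2 : ∑ x ∈ E, ∑ y ∈ E.erase x, rate α x y * f y ^ 2
        = ∑ x ∈ E, ∑ y ∈ E.erase x, rate α x y * f x ^ 2 := by
      have : ∀ F : Pt d → Pt d → ℝ, ∑ x ∈ E, ∑ y ∈ E.erase x, F x y
          = ∑ x ∈ E, ∑ y ∈ E, if x ≠ y then F x y else 0 := by
        intro F
        refine Finset.sum_congr rfl fun x _ => ?_
        rw [← Finset.sum_filter, Finset.filter_ne]
      rw [this, this, Finset.sum_comm]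
      refine Finset.sum_congr rfl fun x _ => Finset.sum_congr rfl fun y _ => ?_
      rw [rate_comm α y x]
      simp only [ne_comm]
    calc ∑ x ∈ E, ∑ y ∈ E.erase x, rate α x y * (f x + f y) ^ 2
        ≤ ∑ x ∈ E, ∑ y ∈ E.erase x, (2 * (rate α x y * f x ^ 2) + 2 * (rate α x y * f y ^ 2)) := by
          refine Finset.sum_le_sum fun x _ => Finset.sum_le_sum fun y _ => ?_
          nlinarith [mul_nonneg (rate_pos α x y).le (sq_nonneg (f x - f y))]
      _ ≤ 4 * W := by
          simp only [Finset.sum_add_distrib, ← Finset.mul_sum]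
          linarith
  have hA : 2 * S ≤ q⁻¹ * energy α E f
      + q / 4 * ∑ x ∈ E, ∑ y ∈ E.erase x, rate α x y * (f x + f y) ^ 2 := by
    rw [hS2, energy, Finset.mul_sum, Finset.mul_sum, ← Finset.sum_add_distrib]
    refine Finset.sum_le_sum fun x hx => ?_
    rw [← Finset.add_sum_erase E _ hx, ← Finset.add_sum_erase E (fun y => rate α x y * _) hx]
    simp only [sub_self, abs_zero, mul_zero, zero_add, ne_eq, OfNat.ofNat_ne_zero,
      not_false_eq_true, zero_pow]
    rw [Finset.mul_sum, Finset.mul_sum, ← Finset.sum_add_distrib]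
    refine Finset.sum_le_sum fun y _ => ?_
    have key : |f x ^ 2 - f y ^ 2| ≤ q⁻¹ * (f x - f y) ^ 2 + q / 4 * (f x + f y) ^ 2 := by
      have e : q⁻¹ * (f x - f y) ^ 2 + q / 4 * (f x + f y) ^ 2
          = q⁻¹ * ((f x - f y) ^ 2 + (q / 2 * (f x + f y)) ^ 2) := by
        ring_nf
        field_simp
      have e2 : |f x ^ 2 - f y ^ 2| = q⁻¹ * (2 * (|f x - f y| * |q / 2 * (f x + f y)|)) := by
        rw [← abs_mul, show (f x - f y) * (q / 2 * (f x + f y)) = q / 2 * (f x ^ 2 - f y ^ 2) by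
          ring, abs_mul, abs_of_pos (by positivity : 0 < q / 2)]
        field_simp
      rw [e, e2, ← sq_abs (f x - f y), ← sq_abs (q / 2 * (f x + f y))]
      refine mul_le_mul_of_nonneg_left ?_ (inv_pos.2 hqpos).le
      nlinarith [sq_nonneg (|f x - f y| - |q / 2 * (f x + f y)|)]
    nlinarith [mul_le_mul_of_nonneg_left key (rate_pos α x y).le]
  have hWf : ∑ x ∈ E, f x ^ 2 ≤ W := Finset.sum_le_sum fun x _ =>
    le_mul_of_one_le_left (sq_nonneg _) (one_le_wgt_three α E x)
  have h3 : q * W ≤ q⁻¹ * energy α E f := by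
    nlinarith [mul_le_mul_of_nonneg_left hB (by positivity : 0 ≤ q / 4)]
  have h4 : q ^ 2 * W ≤ energy α E f := by
    have := mul_le_mul_of_nonneg_left h3 hq0
    rw [mul_inv_cancel_left₀ hqpos.ne'] at this
    linarith
  exact (mul_le_mul_of_nonneg_left hWf (sq_nonneg q)).trans h4

lemma nuStar_one (α : ℝ) {E : Finset (Pt d)} (hE : E.Nonempty) :
    nuStar α E 1 = (E.card : ℝ)⁻¹ := by
  have : nu α E 1 '' (E : Set (Pt d)) = {(E.card : ℝ)⁻¹} := by
    rw [funext (nu_one α E)]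
    exact Set.Nonempty.image_const (by simpa using hE) _
  rw [nuStar, this, csInf_singleton]

lemma nuSet_one (α : ℝ) (E U : Finset (Pt d)) : nuSet α E 1 U = U.card / E.card := by
  simp [nuSet, nu_one, div_eq_mul_inv]

lemma hybridProfile_sq_le_specProfile (α : ℝ) {E : Finset (Pt d)} (hE : E.Nonempty) {r : ℝ}
    (hr : nuStar α E 1 ≤ r) (hr1 : r < 1) :
    ENNReal.ofReal (1 / 2) * hybridProfile α E r ^ 2 ≤ ENNReal.ofReal (specProfile α E 1 r) := by
  have hc : (0 : ℝ) < E.card := by exact_mod_cast hE.card_pos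
  obtain ⟨x₀, hx₀⟩ := id hE
  rw [nuStar_one α hE] at hr
  have hle : ∀ V ⊆ E, V.Nonempty → (V.card : ℝ) ≤ r * E.card →
      hybridProfile α E r ≤ ENNReal.ofReal (conduct α E 3 V) := fun V h1 h2 h3 =>
    iInf_le_of_le V <| iInf_le_of_le h1 <| iInf_le_of_le h2 <| iInf_le_of_le h3 le_rfl
  have htop : hybridProfile α E r ≠ ⊤ := by
    refine ne_top_of_le_ne_top ENNReal.ofReal_ne_top
      (hle {x₀} (by simpa using hx₀) (Finset.singleton_nonempty _) ?_)
    rw [inv_le_iff_one_le_mul₀ hc] at hr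
    simpa using hr
  set q := (hybridProfile α E r).toReal with hq
  have hq0 : 0 ≤ q := ENNReal.toReal_nonneg
  rw [← ENNReal.ofReal_toReal htop, ← hq, ← ENNReal.ofReal_pow hq0,
    ← ENNReal.ofReal_mul (by norm_num)]
  refine ENNReal.ofReal_le_ofReal ?_
  refine le_csInf ⟨_, {x₀}, by simpa using hx₀, ?_, ?_, rfl⟩ ?_
  · rw [nuStar_one α hE, nuSet_one]; simp
  · rw [nuSet_one]; simpa using hr
  rintro _ ⟨U, hUE, hU1, hU2, rfl⟩
  rw [nuStar_one α hE, nuSet_one] at hU1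
  rw [nuSet_one, div_le_iff₀ hc] at hU2
  have hUn : U.Nonempty := by
    rw [Finset.nonempty_iff_ne_empty]
    rintro rfl
    simp [hE.ne_empty] at hU1
  have hUlt : U.card < E.card := by
    have : (U.card : ℝ) < E.card := hU2.trans_lt (by nlinarith)
    exact_mod_cast this
  refine le_csInf ?_ ?_
  · obtain ⟨x, hx⟩ := hUn
    obtain ⟨y, hyE, hyU⟩ := Finset.exists_mem_notMem_of_card_lt_card hUlt
    refine ⟨_, fun z => if z ∈ U then 1 else 0, ⟨fun z _ => by positivity,
      ⟨x, hUE hx, y, hyE, by simp [hx, hyU]⟩, fun z _ hz => by simp [hz]⟩, rfl⟩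
  · rintro _ ⟨f, ⟨hf0, hfn, hfU⟩, rfl⟩
    have hvar := varNu_one_pos α hfn
    rw [le_div_iff₀ hvar, dirichlet_one, le_div_iff₀ (by positivity)]
    have hcond : ∀ V ⊆ U, V.Nonempty → q ≤ conduct α E 3 V := fun V hVU hVn => by
      refine ENNReal.toReal_le_of_le_ofReal (conduct_three_nonneg α E V)
        (hle V (hVU.trans hUE) hVn (le_trans ?_ hU2))
      exact_mod_cast Finset.card_le_card hVU
    have h1 := sq_mul_sum_le_energy α E U q hq0 hcond f hfU
    have h2 := varNu_one_le α hE f 0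
    simp only [sub_zero] at h2
    have h3 : varNu α E 1 f * E.card ≤ ∑ x ∈ E, f x ^ 2 := by
      have := mul_le_mul_of_nonneg_right h2 hc.le
      rwa [mul_comm (E.card : ℝ)⁻¹, mul_assoc, inv_mul_cancel₀ hc.ne', mul_one] at this
    nlinarith [mul_le_mul_of_nonneg_left h3 (sq_nonneg q)]

/-! ### Good boxes in a Bernoulli field -/

/-- The grid `{-n, …, n-1}^d`. -/
def grid (d n : ℕ) : Finset (Fin d → ℤ) :=
  Fintype.piFinset fun _ => Finset.Ico (-(n : ℤ)) n

lemma mem_grid {n : ℕ} {u : Fin d → ℤ} : u ∈ grid d n ↔ ∀ i, -(n : ℤ) ≤ u i ∧ u i < n := by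
  simp [grid]

lemma card_grid (d n : ℕ) : (grid d n).card = (2 * n) ^ d := by
  simp only [grid, Fintype.card_piFinset, Int.card_Ico, Finset.prod_const, Finset.card_univ,
    Fintype.card_fin]
  congr 1
  omega

/-- The cell of side `b` with index `j`. -/
def cellSet (b : ℕ) (j : Fin d → ℤ) : Finset (Fin d → ℤ) :=
  Fintype.piFinset fun i => Finset.Ico (b * j i) (b * j i + b)

lemma mem_cellSet_iff {b : ℕ} (hb : 0 < b) {j v : Fin d → ℤ} :
    v ∈ cellSet b j ↔ ∀ i, v i / b = j i := by
  have hb' : (0 : ℤ) < b := by exact_mod_cast hb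
  simp only [cellSet, Fintype.mem_piFinset, Finset.mem_Ico]
  refine forall_congr' fun i => ⟨fun h => ?_, fun h => ?_⟩
  · rw [Int.ediv_eq_iff_of_pos hb']
    constructor <;> linarith [h.1, h.2, mul_comm (b : ℤ) (j i)]
  · rw [Int.ediv_eq_iff_of_pos hb'] at h
    constructor <;> linarith [h.1, h.2, mul_comm (b : ℤ) (j i)]

/-- The sites of the cell of `u` at sup-distance at most `m` from `u`. -/
def nearSet (b : ℕ) (u : Fin d → ℤ) (m : ℕ) : Finset (Fin d → ℤ) :=
  Fintype.piFinset fun i =>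
    Finset.Icc (max (b * (u i / b)) (u i - m)) (min (b * (u i / b) + b - 1) (u i + m))

lemma mem_nearSet {b m : ℕ} {u v : Fin d → ℤ} :
    v ∈ nearSet b u m ↔ ∀ i, (b * (u i / b) ≤ v i ∧ v i < b * (u i / b) + b) ∧
      u i - m ≤ v i ∧ v i ≤ u i + m := by
  simp only [nearSet, Fintype.mem_piFinset, Finset.mem_Icc, max_le_iff, le_min_iff]
  refine forall_congr' fun i => ?_
  omega

lemma nearSet_subset {b : ℕ} (u : Fin d → ℤ) (m : ℕ) :
    nearSet b u m ⊆ cellSet b fun i => u i / b := by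
  intro v hv
  rw [mem_nearSet] at hv
  simp only [cellSet, Fintype.mem_piFinset, Finset.mem_Ico]
  exact fun i => (hv i).1

lemma cellSet_subset_nearSet {b : ℕ} (hb : 0 < b) (u : Fin d → ℤ) :
    cellSet b (fun i => u i / b) ⊆ nearSet b u b := by
  intro v hv
  simp only [cellSet, Fintype.mem_piFinset, Finset.mem_Ico] at hv
  rw [mem_nearSet]
  intro i
  have hb' : (0 : ℤ) < b := by exact_mod_cast hb
  have h1 := Int.mul_ediv_add_emod (u i) b
  have h2 := Int.emod_nonneg (u i) hb'.ne'
  have h3 := Int.emod_lt_of_pos (u i) hb'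
  have := hv i
  refine ⟨hv i, ?_, ?_⟩ <;> linarith [this.1, this.2]

lemma le_card_nearSet {b m : ℕ} (hm : m < b) (u : Fin d → ℤ) :
    (m + 1) ^ d ≤ (nearSet b u m).card := by
  rw [nearSet, Fintype.card_piFinset]
  have : ∏ _i : Fin d, (m + 1) = (m + 1) ^ d := by simp
  rw [← this]
  refine Finset.prod_le_prod' fun i _ => ?_
  rw [Int.card_Icc]
  have hb' : (0 : ℤ) < b := by omega
  have h1 := Int.mul_ediv_add_emod (u i) b
  have h2 := Int.emod_nonneg (u i) hb'.ne'
  have h3 := Int.emod_lt_of_pos (u i) hb'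
  generalize (b : ℤ) * (u i / b) = a at *
  omega

/-- A cost which dominates `T r`, with `r` the distance of `u` to the closest open site of its
cell, whenever there is such a site. -/
def searchCost (T : ℕ → ℝ) (b : ℕ) (u : Fin d → ℤ) (ω : (Fin d → ℤ) → Bool) : ℝ :=
  T 0 + ∑ m ∈ Finset.range b, if ∀ v ∈ nearSet b u m, ω v = false then T (m + 1) else 0

lemma searchCost_congr (T : ℕ → ℝ) {b : ℕ} {u : Fin d → ℤ} {ω ω' : (Fin d → ℤ) → Bool}
    (h : ∀ v ∈ cellSet b (fun i => u i / b), ω v = ω' v) :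
    searchCost T b u ω = searchCost T b u ω' := by
  unfold searchCost
  congr 1
  refine Finset.sum_congr rfl fun m _ => ?_
  have : (∀ v ∈ nearSet b u m, ω v = false) ↔ ∀ v ∈ nearSet b u m, ω' v = false :=
    forall₂_congr fun v hv => by rw [h v (nearSet_subset u m hv)]
  simp only [this]

lemma exists_le_searchCost {T : ℕ → ℝ} (hT : ∀ m, 0 ≤ T m) {b : ℕ} (hb : 0 < b)
    {u : Fin d → ℤ} {ω : (Fin d → ℤ) → Bool}
    (h : ∃ v ∈ cellSet b (fun i => u i / b), ω v = true) :
    ∃ v : Fin d → ℤ, ∃ r : ℕ, ω v = true ∧ v ∈ cellSet b (fun i => u i / b) ∧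
      (∀ i, |u i - v i| ≤ r) ∧ r ≤ b ∧ T r ≤ searchCost T b u ω := by
  classical
  have hex : ∃ m, ∃ v ∈ nearSet b u m, ω v = true :=
    ⟨b, h.imp fun v hv => ⟨cellSet_subset_nearSet hb u hv.1, hv.2⟩⟩
  obtain ⟨v, hv, hωv⟩ := Nat.find_spec hex
  have hle : Nat.find hex ≤ b :=
    Nat.find_min' hex (h.imp fun v hv => ⟨cellSet_subset_nearSet hb u hv.1, hv.2⟩)
  refine ⟨v, Nat.find hex, hωv, nearSet_subset _ _ hv, fun i => ?_, hle, ?_⟩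
  · have := ((mem_nearSet.1 hv) i).2
    rw [abs_le]
    constructor <;> linarith [this.1, this.2]
  · rcases hm : Nat.find hex with _ | m
    · exact le_add_of_nonneg_right (Finset.sum_nonneg fun m _ => by split_ifs <;> simp [hT])
    · have hnone : ∀ v ∈ nearSet b u m, ω v = false := by
        intro v hv
        by_contra hne
        exact Nat.find_min hex (m := m) (by omega) ⟨v, hv, by simpa using hne⟩
      refine le_trans ?_ (le_add_of_nonneg_left (hT 0))
      have := Finset.single_le_sum (f := fun m => if ∀ v ∈ nearSet b u m, ω v = false then
        T (m + 1) else 0) (s := Finset.range b) (fun m _ => by split_ifs <;> simp [hT])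
        (Finset.mem_range.2 (by omega : m < b))
      simpa only [if_pos hnone] using this

lemma searchCost_nonneg {T : ℕ → ℝ} (hT : ∀ m, 0 ≤ T m) (b : ℕ) (u : Fin d → ℤ)
    (ω : (Fin d → ℤ) → Bool) : 0 ≤ searchCost T b u ω :=
  add_nonneg (hT 0) (Finset.sum_nonneg fun m _ => by split_ifs <;> simp [hT])

lemma searchCost_le {T : ℕ → ℝ} (hT : ∀ m, 0 ≤ T m) (hmono : Monotone T) (b : ℕ) (u : Fin d → ℤ)
    (ω : (Fin d → ℤ) → Bool) : searchCost T b u ω ≤ (b + 1) * T b := by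
  have : ∑ m ∈ Finset.range b, (if ∀ v ∈ nearSet b u m, ω v = false then T (m + 1) else 0)
      ≤ ∑ m ∈ Finset.range b, T b := by
    refine Finset.sum_le_sum fun m hm => ?_
    have := hmono (Nat.succ_le_of_lt (Finset.mem_range.1 hm))
    split_ifs
    · exact this
    · exact hT b
  rw [Finset.sum_const, Finset.card_range, nsmul_eq_mul] at this
  have h0 := hmono (Nat.zero_le b)
  unfold searchCost
  linarith

lemma measurableSet_allFalse {ι : Type*} (S : Finset ι) :
    MeasurableSet {ω : ι → Bool | ∀ v ∈ S, ω v = false} := by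
  have : {ω : ι → Bool | ∀ v ∈ S, ω v = false} = ⋂ v ∈ S, (fun ω => ω v) ⁻¹' {false} := by
    ext; simp
  rw [this]
  exact S.measurableSet_biInter fun v _ => measurable_pi_apply v (MeasurableSet.singleton _)

lemma measurable_searchCost (T : ℕ → ℝ) (b : ℕ) (u : Fin d → ℤ) :
    Measurable (searchCost T b u) := by
  refine measurable_const.add (Finset.measurable_fun_sum _ fun m _ => ?_)
  exact Measurable.ite (measurableSet_allFalse _) measurable_const measurable_const

lemma IsBernoulliField.measure_allFalse {ν : Measure ((Fin d → ℤ) → Bool)}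
    (hν : IsBernoulliField d (1 / 2) ν) (S : Finset (Fin d → ℤ)) :
    ν.real {ω | ∀ v ∈ S, ω v = false} = (1 / 2) ^ S.card := by
  rw [measureReal_def, hν.2 S fun _ => false]
  simp only [Bool.false_eq_true, if_false, Finset.prod_const, ENNReal.toReal_pow]
  rw [ENNReal.toReal_ofReal (by norm_num)]
  norm_num

lemma IsBernoulliField.measure_allFalse_le {ν : Measure ((Fin d → ℤ) → Bool)}
    (hν : IsBernoulliField d (1 / 2) ν) {b m : ℕ} (hm : m < b) (u : Fin d → ℤ) :
    ν.real {ω | ∀ v ∈ nearSet b u m, ω v = false} ≤ (1 / 2) ^ (m + 1) ^ d := by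
  rw [hν.measure_allFalse]
  exact pow_le_pow_of_le_one (by norm_num) (by norm_num) (le_card_nearSet hm u)

lemma IsBernoulliField.integral_searchCost_le {ν : Measure ((Fin d → ℤ) → Bool)}
    (hν : IsBernoulliField d (1 / 2) ν) {T : ℕ → ℝ} (hT : ∀ m, 0 ≤ T m)
    (hsum : Summable fun m : ℕ => T (m + 1) * (1 / 2) ^ (m + 1) ^ d) (b : ℕ) (u : Fin d → ℤ) :
    ∫ ω, searchCost T b u ω ∂ν ≤ T 0 + ∑' m : ℕ, T (m + 1) * (1 / 2) ^ (m + 1) ^ d := by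
  have := hν.1
  have hind : ∀ m, (fun ω : (Fin d → ℤ) → Bool =>
      if ∀ v ∈ nearSet b u m, ω v = false then T (m + 1) else 0)
      = Set.indicator {ω | ∀ v ∈ nearSet b u m, ω v = false} fun _ => T (m + 1) := by
    intro m
    ext ω
    simp [Set.indicator_apply]
  have h_integrable : ∀ m, Integrable (fun ω : (Fin d → ℤ) → Bool =>
      if ∀ v ∈ nearSet b u m, ω v = false then T (m + 1) else 0) ν := by
    intro m
    rw [hind]
    exact (integrable_const _).indicator (measurableSet_allFalse _)
  unfold searchCost
  rw [integral_add (integrable_const _) (integrable_finsetSum _ fun m _ => h_integrable m),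
    integral_finsetSum _ fun m _ => h_integrable m]
  simp only [integral_const, probReal_univ, one_smul]
  gcongr
  refine le_trans (Finset.sum_le_sum fun m hm => ?_) (hsum.sum_le_tsum (Finset.range b)
    fun m _ => mul_nonneg (hT _) (by positivity))
  rw [hind, integral_indicator_const _ (measurableSet_allFalse _), smul_eq_mul, mul_comm]
  exact mul_le_mul_of_nonneg_left (hν.measure_allFalse_le (Finset.mem_range.1 hm) u) (hT _)

open ProbabilityTheory in
lemma IsBernoulliField.iIndepFun_eval {p : ℝ} {ν : Measure ((Fin d → ℤ) → Bool)}
    (hν : IsBernoulliField d p ν) :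
    iIndepFun (fun (i : Fin d → ℤ) (ω : (Fin d → ℤ) → Bool) => ω i) ν := by
  have := hν.1
  have hset : iIndepSet (fun i : Fin d → ℤ => {ω : (Fin d → ℤ) → Bool | ω i = true}) ν := by
    have hmeas : ∀ i, MeasurableSet {ω : (Fin d → ℤ) → Bool | ω i = true} := fun i =>
      measurableSet_eq_fun (measurable_pi_apply i) measurable_const
    refine (iIndepSet_iff_meas_biInter hmeas).2 fun S => ?_
    have h1 := hν.2 S fun _ => true
    have h2 : ∀ i, ν {ω | ω i = true} = ENNReal.ofReal p := by
      intro i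
      simpa using hν.2 {i} fun _ => true
    simp only [h2]
    simp only [if_true] at h1
    rw [← h1]
    congr 1
    ext
    simp
  rw [iIndepFun_iff_iIndep]
  rw [iIndepSet_iff_iIndep] at hset
  convert hset using 2 with i
  have : (inferInstance : MeasurableSpace Bool) = MeasurableSpace.generateFrom {{true}} := by
    refine le_antisymm (fun s _ => ?_) (MeasurableSpace.generateFrom_le fun s _ => trivial)
    have ht : MeasurableSet[MeasurableSpace.generateFrom {{true}}] ({true} : Set Bool) :=
      MeasurableSpace.measurableSet_generateFrom rfl
    have hf : MeasurableSet[MeasurableSpace.generateFrom {{true}}] ({false} : Set Bool) := by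
      have : ({false} : Set Bool) = {true}ᶜ := by ext x; cases x <;> simp
      rw [this]
      exact ht.compl
    have hs : s = ⋃ x ∈ s, {x} := by simp
    rw [hs]
    refine MeasurableSet.biUnion (Set.to_countable s) fun x _ => ?_
    cases x
    · exact hf
    · exact ht
  rw [show Bool.instMeasurableSpace = _ from this, MeasurableSpace.comap_generateFrom,
    Set.image_singleton]
  rfl

open ProbabilityTheory in
/-- Functions of disjoint finite blocks of independent variables are independent. -/
lemma iIndepFun_of_disjoint_blocks {ι κ : Type*} [DecidableEq ι]
    {ν : Measure (ι → Bool)} (hν : iIndepFun (fun (i : ι) (ω : ι → Bool) => ω i) ν)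
    (Q : κ → Finset ι) (hQ : Pairwise fun j k => Disjoint (Q j) (Q k)) (Y : κ → (ι → Bool) → ℝ)
    (hY : ∀ k ω ω', (∀ i ∈ Q k, ω i = ω' i) → Y k ω = Y k ω') : iIndepFun Y ν := by
  classical
  have := hν.isProbabilityMeasure
  have key : ∀ (S : Finset ι) (A : Set (ι → Bool)),
      (∀ ω ω', (∀ i ∈ S, ω i = ω' i) → ω ∈ A → ω' ∈ A) →
      ∃ B : Set (S → Bool), A = (fun ω (i : S) => ω i) ⁻¹' B := by
    intro S A hA
    refine ⟨(fun ω (i : S) => ω i) '' A, Set.Subset.antisymm (Set.subset_preimage_image _ _) ?_⟩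
    rintro ω ⟨ω', hω', he⟩
    exact hA ω' ω (fun i hi => congrFun he ⟨i, hi⟩) hω'
  rw [iIndepFun_iff_measure_inter_preimage_eq_mul]
  intro S sets _
  induction S using Finset.induction_on with
  | empty => simp
  | insert k S hk ih =>
    rw [Finset.prod_insert hk, ← ih fun i hi => by simp_all, Finset.set_biInter_insert]
    obtain ⟨B₁, hB₁⟩ := key (Q k) (Y k ⁻¹' sets k) fun ω ω' h hω => by
      simpa only [Set.mem_preimage, hY k ω ω' h] using hω
    obtain ⟨B₂, hB₂⟩ := key (S.biUnion Q) (⋂ i ∈ S, Y i ⁻¹' sets i) fun ω ω' h hω => by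
      simp only [Set.mem_iInter, Set.mem_preimage] at hω ⊢
      intro i hi
      rw [← hY i ω ω' fun v hv => h v (Finset.mem_biUnion.2 ⟨i, hi, hv⟩)]
      exact hω i hi
    rw [hB₁, hB₂]
    have hdisj : Disjoint (Q k) (S.biUnion Q) := by
      rw [Finset.disjoint_biUnion_right]
      exact fun i hi => hQ fun h => hk (h ▸ hi)
    have hindep := hν.indepFun_finset _ _ hdisj fun i => measurable_pi_apply i
    exact hindep.measure_inter_preimage_eq_mul _ _ .of_discrete .of_discrete

lemma sum_Ico_blocks (f : ℤ → ℝ) {b : ℕ} (hb : 0 < b) (N : ℕ) :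
    ∑ t ∈ Finset.Ico (-((b * N : ℕ) : ℤ)) ((b * N : ℕ) : ℤ), f t
      = ∑ j ∈ Finset.Ico (-(N : ℤ)) N, ∑ t ∈ Finset.Ico (b * j) (b * j + b), f t := by
  have hb' : (0 : ℤ) < b := by exact_mod_cast hb
  have hmaps : ∀ t ∈ Finset.Ico (-((b * N : ℕ) : ℤ)) ((b * N : ℕ) : ℤ),
      t / (b : ℤ) ∈ Finset.Ico (-(N : ℤ)) N := by
    intro t ht
    rw [Finset.mem_Ico] at ht ⊢
    rw [Int.le_ediv_iff_mul_le hb', Int.ediv_lt_iff_lt_mul hb']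
    push_cast at ht
    constructor <;> linarith [ht.1, ht.2, mul_comm (b : ℤ) N]
  rw [← Finset.sum_fiberwise_of_maps_to hmaps]
  refine Finset.sum_congr rfl fun j hj => Finset.sum_congr ?_ fun _ _ => rfl
  ext t
  rw [Finset.mem_Ico] at hj
  rw [Finset.mem_filter, Finset.mem_Ico, Finset.mem_Ico, Int.ediv_eq_iff_of_pos hb']
  push_cast
  constructor
  · rintro ⟨-, h⟩
    constructor <;> linarith [h.1, h.2, mul_comm (b : ℤ) j]
  · rintro ⟨h1, h2⟩
    refine ⟨⟨?_, ?_⟩, ?_, ?_⟩ <;> nlinarith [hj.1, hj.2]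

open ProbabilityTheory in
lemma IsBernoulliField.measure_line_le {ν : Measure ((Fin d → ℤ) → Bool)}
    (hν : IsBernoulliField d (1 / 2) ν) {T : ℕ → ℝ} (hT : ∀ m, 0 < T m) (hmono : Monotone T)
    (hsum : Summable fun m : ℕ => T (m + 1) * (1 / 2) ^ (m + 1) ^ d) {b N : ℕ} (hb : 0 < b)
    (hN : 0 < N) (u : Fin d → ℤ) (i : Fin d) :
    ν.real {ω | (T 0 + ∑' m : ℕ, T (m + 1) * (1 / 2) ^ (m + 1) ^ d + 1) * (2 * (b * N : ℕ)) ≤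
      ∑ t ∈ Finset.Ico (-((b * N : ℕ) : ℤ)) ((b * N : ℕ) : ℤ),
        searchCost T b (Function.update u i t) ω}
      ≤ Real.exp (-(4 * N / ((b + 1) * T b) ^ 2)) := by
  have := hν.1
  have hT0 : ∀ m, 0 ≤ T m := fun m => (hT m).le
  set A := T 0 + ∑' m : ℕ, T (m + 1) * (1 / 2) ^ (m + 1) ^ d with hA
  set Y : ℤ → ((Fin d → ℤ) → Bool) → ℝ := fun j ω =>
    ∑ t ∈ Finset.Ico ((b : ℤ) * j) (b * j + b), searchCost T b (Function.update u i t) ω with hYdef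
  have hbR : (0 : ℝ) < b := by exact_mod_cast hb
  have hNR : (0 : ℝ) < N := by exact_mod_cast hN
  have hYm : ∀ j, Measurable (Y j) := fun j =>
    Finset.measurable_fun_sum _ fun t _ => measurable_searchCost T b _
  set M : ℝ := b * ((b + 1) * T b) with hM
  have hMpos : 0 < M := mul_pos hbR (mul_pos (by positivity) (hT b))
  have hY0 : ∀ j ω, Y j ω ∈ Set.Icc 0 M := by
    intro j ω
    refine ⟨Finset.sum_nonneg fun t _ => searchCost_nonneg hT0 _ _ _, ?_⟩
    refine (Finset.sum_le_sum fun t _ => searchCost_le hT0 hmono b _ ω).trans ?_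
    simp [hM]
  have hYint : ∀ j, ∫ ω, Y j ω ∂ν ≤ b * A := by
    intro j
    rw [hYdef, integral_finsetSum]
    · refine (Finset.sum_le_sum fun t _ => hν.integral_searchCost_le hT0 hsum b _).trans_eq ?_
      rw [Finset.sum_const, Int.card_Ico, nsmul_eq_mul, hA]
      simp
    · intro t _
      refine Integrable.of_bound (measurable_searchCost T b _).aestronglyMeasurable
        ((b + 1) * T b) (Filter.Eventually.of_forall fun ω => ?_)
      rw [Real.norm_of_nonneg (searchCost_nonneg hT0 _ _ _)]
      exact searchCost_le hT0 hmono b _ ω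
  have hind : iIndepFun Y ν := by
    refine iIndepFun_of_disjoint_blocks hν.iIndepFun_eval
      (fun j => cellSet b (Function.update (fun l => u l / b) i j)) ?_ Y ?_
    · intro j k hjk
      rw [Finset.disjoint_left]
      intro v hv hv'
      rw [mem_cellSet_iff hb] at hv hv'
      have h1 := hv i
      have h2 := hv' i
      simp only [Function.update_self] at h1 h2
      exact hjk (h1.symm.trans h2)
    · intro j ω ω' h
      refine Finset.sum_congr rfl fun t ht => searchCost_congr T fun v hv => h v ?_
      rw [mem_cellSet_iff hb] at hv ⊢
      intro l
      rw [hv l]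
      by_cases hl : l = i
      · subst hl
        rw [Function.update_self, Function.update_self,
          Int.ediv_eq_iff_of_pos (by exact_mod_cast hb)]
        rw [Finset.mem_Ico] at ht
        constructor <;> linarith [ht.1, ht.2, mul_comm (b : ℤ) j]
      · rw [Function.update_of_ne hl, Function.update_of_ne hl]
  have hind' : iIndepFun (fun j ω => Y j ω - ∫ ω, Y j ω ∂ν) ν :=
    hind.comp (fun j x => x - ∫ ω, Y j ω ∂ν) fun j => measurable_id.sub_const _
  have hho := HasSubgaussianMGF.measure_sum_ge_le_of_iIndepFun hind'
    (s := Finset.Ico (-(N : ℤ)) N) (fun j _ => hasSubgaussianMGF_of_mem_Icc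
      (hYm j).aemeasurable (Filter.Eventually.of_forall (hY0 j)))
    (ε := 2 * N * b) (by positivity)
  refine le_trans (measureReal_mono ?_) (hho.trans_eq ?_)
  · intro ω hω
    simp only [Set.mem_ofPred_eq] at hω ⊢
    rw [sum_Ico_blocks _ hb] at hω
    rw [Finset.sum_sub_distrib]
    have h1 : ∑ j ∈ Finset.Ico (-(N : ℤ)) N, ∫ ω, Y j ω ∂ν ≤ 2 * N * (b * A) := by
      refine (Finset.sum_le_sum fun j _ => hYint j).trans_eq ?_
      simp only [Finset.sum_const, Int.card_Ico, nsmul_eq_mul]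
      congr 1
      have : ((N : ℤ) - -(N : ℤ)).toNat = 2 * N := by omega
      rw [this]
      push_cast
      ring
    have h2 : ∑ j ∈ Finset.Ico (-(N : ℤ)) N, Y j ω
      = ∑ j ∈ Finset.Ico (-(N : ℤ)) N, ∑ t ∈ Finset.Ico ((b : ℤ) * j) (b * j + b),
        searchCost T b (Function.update u i t) ω := rfl
    rw [← h2] at hω
    push_cast at hω
    linarith
  · congr 1
    have hc : ((‖M - 0‖₊ / 2 : NNReal) : ℝ) = M / 2 := by
      simp [abs_of_pos hMpos]
    have hcard : ((N : ℤ) - -(N : ℤ)).toNat = 2 * N := by omega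
    simp only [Finset.sum_const, Int.card_Ico, nsmul_eq_mul, hcard, NNReal.coe_mul,
      NNReal.coe_pow, NNReal.coe_natCast, hc]
    rw [hM]
    have := hT b
    push_cast
    field_simp
    ring

/-- All lines of the grid have linear total search cost, and all its cells contain an open site. -/
def GoodField (T : ℕ → ℝ) (A : ℝ) (b N : ℕ) (ω : (Fin d → ℤ) → Bool) : Prop :=
  (∀ u ∈ grid d (b * N), ∀ i, ∑ t ∈ Finset.Ico (-((b * N : ℕ) : ℤ)) ((b * N : ℕ) : ℤ),
    searchCost T b (Function.update u i t) ω ≤ A * (2 * (b * N : ℕ))) ∧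
  ∀ u ∈ grid d (b * N), ∃ v ∈ cellSet b (fun i => u i / (b : ℤ)), ω v = true

lemma IsBernoulliField.measure_not_goodField_le {ν : Measure ((Fin d → ℤ) → Bool)}
    (hν : IsBernoulliField d (1 / 2) ν) {T : ℕ → ℝ} (hT : ∀ m, 0 < T m) (hmono : Monotone T)
    (hsum : Summable fun m : ℕ => T (m + 1) * (1 / 2) ^ (m + 1) ^ d) {b N : ℕ} (hb : 0 < b)
    (hN : 0 < N) :
    ν.real {ω | ¬ GoodField T (T 0 + ∑' m : ℕ, T (m + 1) * (1 / 2) ^ (m + 1) ^ d + 1) b N ω}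
      ≤ (2 * (b * N : ℕ)) ^ d *
        (d * Real.exp (-(4 * N / ((b + 1) * T b) ^ 2)) + (1 / 2) ^ b ^ d) := by
  have := hν.1
  set A := T 0 + ∑' m : ℕ, T (m + 1) * (1 / 2) ^ (m + 1) ^ d + 1
  have hsub : {ω : (Fin d → ℤ) → Bool | ¬ GoodField T A b N ω} ⊆ ⋃ u ∈ grid d (b * N),
      ((⋃ i ∈ (Finset.univ : Finset (Fin d)), {ω | A * (2 * (b * N : ℕ)) ≤
        ∑ t ∈ Finset.Ico (-((b * N : ℕ) : ℤ)) ((b * N : ℕ) : ℤ),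
          searchCost T b (Function.update u i t) ω}) ∪
      {ω | ∀ v ∈ nearSet b u (b - 1), ω v = false}) := by
    intro ω hω
    simp only [Set.mem_iUnion, Set.mem_union, Set.mem_ofPred_eq, Finset.mem_univ, exists_prop,
      true_and]
    by_contra hcon
    push Not at hcon
    refine hω ⟨fun u hu i => ((hcon u hu).1 i).le, fun u hu => ?_⟩
    obtain ⟨v, hv, hωv⟩ := (hcon u hu).2
    exact ⟨v, nearSet_subset u _ hv, by simpa using hωv⟩
  refine (measureReal_mono hsub (measure_ne_top _ _)).trans
    ((measureReal_biUnion_finset_le _ _).trans ?_)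
  have hterm : ∀ u ∈ grid d (b * N), ν.real
      ((⋃ i ∈ (Finset.univ : Finset (Fin d)), {ω | A * (2 * (b * N : ℕ)) ≤
        ∑ t ∈ Finset.Ico (-((b * N : ℕ) : ℤ)) ((b * N : ℕ) : ℤ),
          searchCost T b (Function.update u i t) ω}) ∪
      {ω | ∀ v ∈ nearSet b u (b - 1), ω v = false})
      ≤ d * Real.exp (-(4 * N / ((b + 1) * T b) ^ 2)) + (1 / 2) ^ b ^ d := by
    intro u _
    refine (measureReal_union_le _ _).trans (add_le_add ?_ ?_)
    · refine (measureReal_biUnion_finset_le _ _).trans ?_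
      refine (Finset.sum_le_sum fun i _ =>
        hν.measure_line_le hT hmono hsum hb hN u i).trans_eq ?_
      simp
    · have := hν.measure_allFalse_le (b := b) (m := b - 1) (by omega) u
      rwa [Nat.sub_add_cancel hb] at this
  refine (Finset.sum_le_sum hterm).trans_eq ?_
  rw [Finset.sum_const, card_grid, nsmul_eq_mul]
  push_cast
  ring

lemma IsBernoulliField.ae_eventually_goodField {ν : Measure ((Fin d → ℤ) → Bool)}
    (hν : IsBernoulliField d (1 / 2) ν) {T : ℕ → ℝ} (hT : ∀ m, 0 < T m) (hmono : Monotone T)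
    (hsum : Summable fun m : ℕ => T (m + 1) * (1 / 2) ^ (m + 1) ^ d) {b N : ℕ → ℕ}
    (hb : ∀ᶠ L in atTop, 0 < b L) (hN : ∀ᶠ L in atTop, 0 < N L)
    (hbN : ∀ᶠ L : ℕ in atTop, (2 * (b L * N L : ℕ) : ℝ) ^ d *
        (d * Real.exp (-(4 * N L / ((b L + 1) * T (b L)) ^ 2)) + (1 / 2) ^ b L ^ d)
          ≤ 1 / (L : ℝ) ^ 2) :
    ∀ᵐ ω ∂ν, ∀ᶠ L in atTop, GoodField T
      (T 0 + ∑' m : ℕ, T (m + 1) * (1 / 2) ^ (m + 1) ^ d + 1) (b L) (N L) ω := by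
  have := hν.1
  set A := T 0 + ∑' m : ℕ, T (m + 1) * (1 / 2) ^ (m + 1) ^ d + 1
  obtain ⟨L₀, hL₀⟩ := eventually_atTop.1 (hb.and (hN.and hbN))
  set s : ℕ → Set ((Fin d → ℤ) → Bool) := fun L =>
    if L₀ ≤ L then {ω | ¬ GoodField T A (b L) (N L) ω} else ∅ with hs
  have hle : ∀ L, ν (s L) ≤ ENNReal.ofReal (1 / (L : ℝ) ^ 2) := by
    intro L
    by_cases hL : L₀ ≤ L
    · obtain ⟨h1, h2, h3⟩ := hL₀ L hL
      simp only [hs, if_pos hL]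
      rw [← ofReal_measureReal]
      exact ENNReal.ofReal_le_ofReal ((hν.measure_not_goodField_le hT hmono hsum h1 h2).trans h3)
    · simp [hs, hL]
  have hfin : ∑' L, ν (s L) ≠ ⊤ := by
    refine ne_top_of_le_ne_top ?_ (ENNReal.tsum_le_tsum hle)
    rw [← ENNReal.ofReal_tsum_of_nonneg (fun _ => by positivity)
      (Real.summable_one_div_nat_pow.2 (by norm_num))]
    exact ENNReal.ofReal_ne_top
  filter_upwards [ae_eventually_notMem hfin] with ω hω
  filter_upwards [hω, eventually_ge_atTop L₀] with L hL hL0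
  simpa [hs, hL0] using hL

/-! ### Choice of scales -/

lemma eventually_mul_rpow_le_rpow (a : ℝ) {c : ℝ} (hc : 0 < c) {p q : ℝ} (hpq : p < q) :
    ∀ᶠ x : ℝ in atTop, a * x ^ p ≤ c * x ^ q := by
  filter_upwards [(tendsto_rpow_atTop (sub_pos.2 hpq)).eventually (eventually_ge_atTop (a / c)),
    eventually_gt_atTop 0] with x hx hx0
  rw [div_le_iff₀ hc, Real.rpow_sub hx0, div_mul_eq_mul_div, le_div_iff₀ (by positivity)] at hx
  linarith

lemma exists_logarithmic_scale {γ : ℝ} (hγ : 0 < γ) (hγd : γ < d) :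
    ∃ b : ℕ → ℕ, (∀ a : ℝ, ∀ᶠ L : ℕ in atTop, a * ((b L : ℝ) + 2) ^ γ ≤ Real.log L) ∧
      ∀ a : ℝ, ∀ᶠ L : ℕ in atTop, a * Real.log L ≤ (b L : ℝ) ^ d := by
  obtain ⟨β, hγβ, hβd⟩ := exists_between hγd
  have hβ : 0 < β := hγ.trans hγβ
  have hlog : Tendsto (fun L : ℕ => Real.log L) atTop atTop :=
    Real.tendsto_log_atTop.comp tendsto_natCast_atTop_atTop
  refine ⟨fun L => ⌊Real.log L ^ (1 / β)⌋₊, fun a => ?_, fun a => ?_⟩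
  · have h1 := eventually_mul_rpow_le_rpow (|a| * 3 ^ γ) one_pos ((div_lt_one hβ).2 hγβ)
    filter_upwards [hlog.eventually h1, hlog.eventually (eventually_ge_atTop 1)] with L hL hL1
    rw [Real.rpow_one, one_mul] at hL
    have h1 : 1 ≤ Real.log L ^ (1 / β) := Real.one_le_rpow hL1 (by positivity)
    have h2 : (⌊Real.log L ^ (1 / β)⌋₊ : ℝ) + 2 ≤ 3 * Real.log L ^ (1 / β) := by
      linarith [Nat.floor_le (zero_le_one.trans h1)]
    calc a * ((⌊Real.log L ^ (1 / β)⌋₊ : ℝ) + 2) ^ γ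
        ≤ |a| * (3 * Real.log L ^ (1 / β)) ^ γ := by
          refine mul_le_mul (le_abs_self a) (Real.rpow_le_rpow (by positivity) h2 hγ.le)
            (by positivity) (abs_nonneg a)
      _ = |a| * 3 ^ γ * Real.log L ^ (γ / β) := by
          rw [Real.mul_rpow (by norm_num) (by positivity), ← Real.rpow_mul (by linarith)]
          ring_nf
      _ ≤ Real.log L := hL
  · have h1 := eventually_mul_rpow_le_rpow (a * 2 ^ d) one_pos ((one_lt_div hβ).2 hβd)
    filter_upwards [hlog.eventually h1, hlog.eventually (eventually_ge_atTop 1)] with L hL hL1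
    rw [Real.rpow_one, one_mul] at hL
    have h1 : 1 ≤ Real.log L ^ (1 / β) := Real.one_le_rpow hL1 (by positivity)
    have h2 : Real.log L ^ (1 / β) ≤ 2 * (⌊Real.log L ^ (1 / β)⌋₊ : ℝ) := by
      have h3 : (1 : ℝ) ≤ ⌊Real.log L ^ (1 / β)⌋₊ := by
        exact_mod_cast (Nat.one_le_floor_iff _).2 h1
      linarith [Nat.lt_floor_add_one (Real.log L ^ (1 / β))]
    have h4 : Real.log L ^ ((d : ℝ) / β) ≤ 2 ^ d * (⌊Real.log L ^ (1 / β)⌋₊ : ℝ) ^ d := by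
      rw [← mul_pow]
      refine le_trans (le_of_eq ?_) (pow_le_pow_left₀ (by positivity) h2 d)
      rw [← Real.rpow_natCast, ← Real.rpow_mul (by linarith)]
      ring_nf
    have h5 : (0 : ℝ) < 2 ^ d := by positivity
    nlinarith

/-- The cost of a lattice step whose end points are represented at distance at most `R`. -/
def stepCost (α K : ℝ) (d R : ℕ) : ℝ :=
  Real.exp ((2 * d * K * (1 + R)) ^ α + d * R * Real.log 2)

lemma stepCost_pos (α K : ℝ) (d R : ℕ) : 0 < stepCost α K d R := Real.exp_pos _

lemma stepCost_mono {α K : ℝ} (hα : 0 ≤ α) (hK : 0 ≤ K) (d : ℕ) : Monotone (stepCost α K d) := by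
  intro R R' h
  have h' : (R : ℝ) ≤ R' := by exact_mod_cast h
  have := Real.log_nonneg (one_le_two (α := ℝ))
  unfold stepCost
  gcongr

lemma mul_rpow_le_rpow_max {α c y z : ℝ} (hα : 0 ≤ α) (hc : 0 ≤ c) (hy : 0 ≤ y) (hyz : y ≤ z)
    (hz : 1 ≤ z) : (c * y) ^ α ≤ c ^ α * z ^ max α 1 := by
  rw [Real.mul_rpow hc hy]
  gcongr
  exact (Real.rpow_le_rpow hy hyz hα).trans (Real.rpow_le_rpow_of_exponent_le hz (le_max_left _ _))

lemma le_rpow_max_one {α z : ℝ} (hz : 1 ≤ z) : z ≤ z ^ max α 1 := by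
  simpa using Real.rpow_le_rpow_of_exponent_le hz (le_max_right α 1)

lemma stepCost_le {α K : ℝ} (hα : 0 ≤ α) (hK : 0 ≤ K) (d R : ℕ) :
    stepCost α K d R ≤ Real.exp (((2 * d * K) ^ α + d) * ((R : ℝ) + 2) ^ max α 1) := by
  refine Real.exp_le_exp.2 ?_
  rw [add_mul]
  have hR : (0 : ℝ) ≤ R := Nat.cast_nonneg R
  refine add_le_add (mul_rpow_le_rpow_max hα (by positivity) (by positivity) (by linarith)
    (by linarith)) ?_
  have h1 : Real.log 2 ≤ 1 := by linarith [Real.log_two_lt_d9]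
  have h2 := le_rpow_max_one (α := α) (z := (R : ℝ) + 2) (by linarith)
  have h3 := Real.log_nonneg (one_le_two (α := ℝ))
  rw [mul_assoc]
  refine mul_le_mul_of_nonneg_left ?_ (Nat.cast_nonneg d)
  nlinarith

lemma summable_stepCost {α K : ℝ} (hα : 0 < α) (hK : 0 ≤ K) (hd : 2 ≤ d) (hαd : α < d) :
    Summable fun m : ℕ => stepCost α K d (m + 1) * (1 / 2) ^ (m + 1) ^ d := by
  have hd' : (1 : ℝ) < d := by exact_mod_cast hd
  set c := (2 * d * K) ^ α + d
  have hlog2 : 0 < Real.log 2 := Real.log_pos one_lt_two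
  have hev := (tendsto_natCast_atTop_atTop (R := ℝ)).eventually
    (eventually_mul_rpow_le_rpow (c * 3 ^ max α 1 + 1) hlog2 (max_lt hαd hd'))
  have hev' := (tendsto_add_atTop_nat 1).eventually hev
  refine Summable.of_norm_bounded_eventually_nat Real.summable_exp_neg_nat ?_
  filter_upwards [hev'] with m hm
  rw [Real.norm_of_nonneg (mul_nonneg (stepCost_pos _ _ _ _).le (by positivity))]
  have hhalf : ((1 : ℝ) / 2) ^ (m + 1) ^ d
      = Real.exp (-(Real.log 2 * ((m + 1 : ℕ) : ℝ) ^ (d : ℝ))) := by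
    rw [one_div, inv_pow, Real.exp_neg, Real.rpow_natCast, mul_comm, ← Nat.cast_pow,
      Real.exp_nat_mul, Real.exp_log two_pos]
  rw [hhalf]
  refine (mul_le_mul_of_nonneg_right (stepCost_le hα.le hK d (m + 1)) (Real.exp_pos _).le).trans ?_
  rw [← Real.exp_add, Real.exp_le_exp]
  have hm1 : (1 : ℝ) ≤ ((m + 1 : ℕ) : ℝ) := by simp
  have h3 : (((m + 1 : ℕ) : ℝ) + 2) ^ max α 1 ≤ 3 ^ max α 1 * ((m + 1 : ℕ) : ℝ) ^ max α 1 := by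
    rw [← Real.mul_rpow (by norm_num) (by linarith)]
    exact Real.rpow_le_rpow (by linarith) (by linarith) (by positivity)
  have h4 := le_rpow_max_one (α := α) hm1
  have hc : 0 ≤ c := by positivity
  have h5 := mul_le_mul_of_nonneg_left h3 hc
  have h6 : (m : ℝ) ≤ ((m + 1 : ℕ) : ℝ) := by simp
  linarith

lemma exists_scales {α K : ℝ} (hα : 0 < α) (hK : 0 < K) (hd : 2 ≤ d) (hαd : α < d) :
    ∃ b N : ℕ → ℕ,
      (∀ᶠ L in atTop, 0 < b L) ∧ (∀ᶠ L in atTop, 0 < N L) ∧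
      (∀ L, 2 * K * (b L * N L : ℕ) ≤ L) ∧
      (∀ᶠ L : ℕ in atTop, (L : ℝ) ≤ 2 * K * (b L * (N L + 1) : ℕ)) ∧
      (∀ c δ : ℝ, 0 ≤ c → 0 < δ →
        ∀ᶠ L : ℕ in atTop, Real.exp (c * ((b L : ℝ) + 2) ^ max α 1) ≤ (L : ℝ) ^ δ) ∧
      ∀ᶠ L : ℕ in atTop, (2 * (b L * N L : ℕ) : ℝ) ^ d *
        (d * Real.exp (-(4 * N L / ((b L + 1) * stepCost α K d (b L)) ^ 2)) + (1 / 2) ^ b L ^ d)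
          ≤ 1 / (L : ℝ) ^ 2 := by
  have hd' : (1 : ℝ) < d := by exact_mod_cast hd
  obtain ⟨b, hb1, hb2⟩ := exists_logarithmic_scale (d := d) (γ := max α 1) (by positivity)
    (max_lt hαd hd')
  have hlog : Tendsto (fun L : ℕ => Real.log L) atTop atTop :=
    Real.tendsto_log_atTop.comp tendsto_natCast_atTop_atTop
  have hexp : ∀ c δ : ℝ, 0 ≤ c → 0 < δ →
      ∀ᶠ L : ℕ in atTop, Real.exp (c * ((b L : ℝ) + 2) ^ max α 1) ≤ (L : ℝ) ^ δ := by
    intro c δ hc hδ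
    filter_upwards [hb1 (c / δ), eventually_gt_atTop 0] with L hL hL0
    rw [Real.rpow_def_of_pos (x := (L : ℝ)) (by exact_mod_cast hL0)]
    refine Real.exp_le_exp.2 ?_
    rw [div_mul_eq_mul_div, div_le_iff₀ hδ] at hL
    exact hL
  have hbpos : ∀ᶠ L in atTop, 0 < b L := by
    filter_upwards [hb2 1, hlog.eventually (eventually_gt_atTop 0)] with L hL hL0
    by_contra hcon
    have : b L = 0 := by omega
    rw [this, Nat.cast_zero, zero_pow (by omega)] at hL
    linarith
  set N : ℕ → ℕ := fun L => ⌊(L : ℝ) / (2 * K * b L)⌋₊ with hN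
  have hup : ∀ L, 2 * K * (b L * N L : ℕ) ≤ L := by
    intro L
    rcases Nat.eq_zero_or_pos (b L) with h0 | h0
    · simp [h0]
    · have h0' : (0 : ℝ) < b L := by exact_mod_cast h0
      have := Nat.floor_le (a := (L : ℝ) / (2 * K * b L)) (by positivity)
      rw [le_div_iff₀ (by positivity)] at this
      push_cast
      linarith
  have hbL : ∀ᶠ L : ℕ in atTop, (b L : ℝ) ≤ (L : ℝ) ^ (1 / 4 : ℝ) := by
    filter_upwards [hexp 1 (1 / 4) zero_le_one (by norm_num)] with L hL
    refine le_trans ?_ hL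
    rw [one_mul]
    have h1 := le_rpow_max_one (α := α) (z := (b L : ℝ) + 2) (by
      linarith [(Nat.cast_nonneg (b L) : (0 : ℝ) ≤ b L)])
    linarith [Real.add_one_le_exp (((b L : ℝ) + 2) ^ max α 1)]
  have hNL : ∀ᶠ L : ℕ in atTop, (L : ℝ) ^ (1 / 2 : ℝ) ≤ N L := by
    have hev := (tendsto_natCast_atTop_atTop (R := ℝ)).eventually
      (eventually_mul_rpow_le_rpow (2 * K * 2) one_pos (show (3 / 4 : ℝ) < 1 by norm_num))
    filter_upwards [hbL, hbpos, hev, eventually_ge_atTop 1] with L hL hL0 hL2 hL1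
    have h1 : (1 : ℝ) ≤ L := by exact_mod_cast hL1
    have hb0 : (0 : ℝ) < b L := by exact_mod_cast hL0
    have h2 : 1 ≤ (L : ℝ) ^ (1 / 2 : ℝ) := Real.one_le_rpow h1 (by norm_num)
    have h3 : 2 * (L : ℝ) ^ (1 / 2 : ℝ) ≤ (L : ℝ) / (2 * K * b L) := by
      rw [le_div_iff₀ (by positivity)]
      have h4 : (L : ℝ) ^ (1 / 2 : ℝ) * (L : ℝ) ^ (1 / 4 : ℝ) = (L : ℝ) ^ (3 / 4 : ℝ) := by
        rw [← Real.rpow_add (by linarith)]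
        norm_num
      rw [Real.rpow_one, one_mul, ← h4] at hL2
      have h5 := mul_le_mul_of_nonneg_left hL (by positivity : 0 ≤ 4 * K * (L : ℝ) ^ (1 / 2 : ℝ))
      linarith
    linarith [Nat.lt_floor_add_one ((L : ℝ) / (2 * K * b L))]
  refine ⟨b, N, hbpos, ?_, hup, ?_, hexp, ?_⟩
  · filter_upwards [hNL, eventually_ge_atTop 1] with L hL hL1
    have h1 : (1 : ℝ) ≤ L := by exact_mod_cast hL1
    have h2 : 1 ≤ (L : ℝ) ^ (1 / 2 : ℝ) := Real.one_le_rpow h1 (by norm_num)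
    have h3 : (1 : ℝ) ≤ N L := h2.trans hL
    exact_mod_cast h3
  · filter_upwards [hbpos] with L h0
    have h0' : (0 : ℝ) < b L := by exact_mod_cast h0
    have := (Nat.lt_floor_add_one ((L : ℝ) / (2 * K * b L))).le
    rw [div_le_iff₀ (by positivity)] at this
    push_cast
    linarith
  · set c := (2 * d * K) ^ α + d
    have hc : 0 ≤ c := by positivity
    have hlog2 : 0 < Real.log 2 := Real.log_pos one_lt_two
    have hev := (tendsto_natCast_atTop_atTop (R := ℝ)).eventually
      ((isLittleO_log_rpow_atTop (show (0 : ℝ) < 1 / 4 by norm_num)).bound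
        (c := 1 / (d + 3)) (by positivity))
    have hbig := (tendsto_natCast_atTop_atTop (R := ℝ)).eventually
      (eventually_ge_atTop ((d + 1) / K ^ d))
    filter_upwards [hNL, hexp (1 + c) (1 / 8) (by positivity) (by norm_num), hev, hbig,
      hb2 ((d + 3) / Real.log 2), eventually_ge_atTop 1] with L hN1 hT hlogL hLbig hbd hL1
    have h1 : (1 : ℝ) ≤ L := by exact_mod_cast hL1
    have hL0 : (0 : ℝ) < L := by linarith
    have hcost : (b L + 1) * stepCost α K d (b L) ≤ (L : ℝ) ^ (1 / 8 : ℝ) := by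
      refine le_trans ?_ hT
      rw [add_mul 1 c, one_mul, Real.exp_add]
      refine mul_le_mul ?_ (stepCost_le hα.le hK.le d (b L)) (stepCost_pos _ _ _ _).le
        (Real.exp_pos _).le
      have h2 := le_rpow_max_one (α := α) (z := (b L : ℝ) + 2) (by
        linarith [(Nat.cast_nonneg (b L) : (0 : ℝ) ≤ b L)])
      linarith [Real.add_one_le_exp (((b L : ℝ) + 2) ^ max α 1)]
    have hcost0 : 0 < (b L + 1) * stepCost α K d (b L) :=
      mul_pos (by positivity) (stepCost_pos _ _ _ _)
    have hexpo : (L : ℝ) ^ (1 / 4 : ℝ) ≤ 4 * N L / ((b L + 1) * stepCost α K d (b L)) ^ 2 := by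
      rw [le_div_iff₀ (by positivity)]
      have h3 : ((b L + 1) * stepCost α K d (b L)) ^ 2 ≤ (L : ℝ) ^ (1 / 4 : ℝ) := by
        refine (pow_le_pow_left₀ hcost0.le hcost 2).trans_eq ?_
        rw [← Real.rpow_natCast, ← Real.rpow_mul hL0.le]
        norm_num
      have h4 : (L : ℝ) ^ (1 / 4 : ℝ) * (L : ℝ) ^ (1 / 4 : ℝ) = (L : ℝ) ^ (1 / 2 : ℝ) := by
        rw [← Real.rpow_add hL0]
        norm_num
      have h5 := mul_le_mul_of_nonneg_left h3 (by positivity : 0 ≤ (L : ℝ) ^ (1 / 4 : ℝ))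
      have h6 : (0 : ℝ) ≤ N L := Nat.cast_nonneg _
      linarith
    have hpow : Real.exp (-((d + 3) * Real.log L)) = 1 / (L : ℝ) ^ (d + 3) := by
      rw [Real.exp_neg, one_div]
      congr 1
      have := Real.exp_nat_mul (Real.log L) (d + 3)
      push_cast at this
      rw [this, Real.exp_log hL0]
    have hA : Real.exp (-(4 * N L / ((b L + 1) * stepCost α K d (b L)) ^ 2))
        ≤ 1 / (L : ℝ) ^ (d + 3) := by
      rw [← hpow, Real.exp_le_exp, neg_le_neg_iff]
      refine le_trans ?_ hexpo
      rw [Real.norm_of_nonneg (Real.log_nonneg h1), Real.norm_of_nonneg (by positivity),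
        one_div_mul_eq_div, le_div_iff₀ (by positivity)] at hlogL
      linarith
    have hB : ((1 : ℝ) / 2) ^ b L ^ d ≤ 1 / (L : ℝ) ^ (d + 3) := by
      have hhalf : ((1 : ℝ) / 2) ^ b L ^ d = Real.exp (-((b L : ℝ) ^ d * Real.log 2)) := by
        rw [one_div, inv_pow, Real.exp_neg, ← Nat.cast_pow, Real.exp_nat_mul,
          Real.exp_log two_pos]
      rw [hhalf, ← hpow, Real.exp_le_exp, neg_le_neg_iff]
      rw [div_mul_eq_mul_div, div_le_iff₀ hlog2] at hbd
      exact hbd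
    have hbox : (2 * (b L * N L : ℕ) : ℝ) ^ d ≤ (L : ℝ) ^ d / K ^ d := by
      rw [← div_pow]
      refine pow_le_pow_left₀ (by positivity) ?_ d
      rw [le_div_iff₀ hK]
      linarith [hup L]
    calc (2 * (b L * N L : ℕ) : ℝ) ^ d *
        (d * Real.exp (-(4 * N L / ((b L + 1) * stepCost α K d (b L)) ^ 2)) + (1 / 2) ^ b L ^ d)
        ≤ (L : ℝ) ^ d / K ^ d * (d * (1 / (L : ℝ) ^ (d + 3)) + 1 / (L : ℝ) ^ (d + 3)) := by
          gcongr
      _ = (d + 1) / K ^ d / L * (1 / (L : ℝ) ^ 2) := by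
          rw [pow_add]
          field_simp
      _ ≤ 1 / (L : ℝ) ^ 2 := by
          refine mul_le_of_le_one_left (by positivity) ?_
          rw [div_le_one hL0]
          exact hLbig

/-! ### Transferring almost sure properties through a coupling -/

open ProbabilityTheory in
lemma ae_exists_of_ae_coupling {Ω Ω' : Type*} [MeasurableSpace Ω] [MeasurableSpace Ω']
    [StandardBorelSpace Ω'] [Nonempty Ω'] {μ : Measure (Ω × Ω')} [IsFiniteMeasure μ]
    {p : Ω × Ω' → Prop} {q : Ω' → Prop} (hp : ∀ᵐ ω ∂μ, p ω)
    (hq : ∀ᵐ z ∂μ.map Prod.snd, q z) : ∀ᵐ ξ ∂μ.map Prod.fst, ∃ z, p (ξ, z) ∧ q z := by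
  have h : ∀ᵐ ω ∂μ, p ω ∧ q ω.2 :=
    hp.and (ae_of_ae_map measurable_snd.aemeasurable hq)
  rw [← μ.disintegrate μ.condKernel] at h
  filter_upwards [Measure.ae_ae_of_ae_compProd h] with ξ hξ
  exact hξ.exists

lemma AssumptionA1.exists_field {P : Measure (Config d)} (hA1 : AssumptionA1 P) {p : ℝ}
    (hp0 : 0 < p) (hp1 : p < 1) :
    ∃ K : ℝ, 0 < K ∧ ∃ ν : Measure ((Fin d → ℤ) → Bool), IsBernoulliField d p ν ∧
      ∀ q : ((Fin d → ℤ) → Bool) → Prop, (∀ᵐ z ∂ν, q z) →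
        ∀ᵐ ξ ∂P, ∃ z, (∀ x, z x = true → (ξ ∩ Kcube d K x).Nonempty) ∧ q z := by
  obtain ⟨K, hK, μ, ν, hμ, hν, rfl, rfl, h⟩ := hA1 p hp0 hp1
  exact ⟨K, hK, _, hν, fun q hq => ae_exists_of_ae_coupling h hq⟩

/-! ### Comparison along lattice paths -/

/-- The lattice box `∏ [lo i, hi i)`. -/
def latticeBox (lo hi : Fin d → ℤ) : Finset (Fin d → ℤ) :=
  Fintype.piFinset fun i => Finset.Ico (lo i) (hi i)

lemma mem_latticeBox {lo hi u : Fin d → ℤ} :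
    u ∈ latticeBox lo hi ↔ ∀ i, lo i ≤ u i ∧ u i < hi i := by
  simp [latticeBox]

lemma update_mem_latticeBox {lo hi u : Fin d → ℤ} (hu : u ∈ latticeBox lo hi) {i : Fin d} {t : ℤ}
    (ht : t ∈ Finset.Ico (lo i) (hi i)) : Function.update u i t ∈ latticeBox lo hi := by
  rw [mem_latticeBox] at hu ⊢
  rw [Finset.mem_Ico] at ht
  intro l
  by_cases hl : l = i
  · subst hl
    simpa using ht
  · simpa [hl] using hu l

lemma sq_sub_le_of_steps {g X D : ℤ → ℝ} {lo hi : ℤ} {B : ℝ} (hX : ∀ t, 0 ≤ X t)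
    (hD : ∀ t, 0 ≤ D t)
    (hstep : ∀ t, lo ≤ t → t + 1 < hi → (g (t + 1) - g t) ^ 2 ≤ (X t + X (t + 1)) * D t)
    (hB : ∑ t ∈ Finset.Ico lo hi, X t ≤ B) {s t : ℤ} (hs : s ∈ Finset.Ico lo hi)
    (ht : t ∈ Finset.Ico lo hi) :
    (g s - g t) ^ 2 ≤ 2 * B * ∑ t ∈ Finset.Ico lo hi, D t := by
  wlog hst : s ≤ t generalizing s t
  · rw [← neg_sub, neg_sq]
    exact this ht hs (le_of_not_ge hst)
  rw [Finset.mem_Ico] at hs ht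
  have htel : ∀ k : ℕ, ∑ r ∈ Finset.Ico s (s + k), (g (r + 1) - g r) = g (s + k) - g s := by
    intro k
    induction k with
    | zero => simp
    | succ k ih =>
      rw [Nat.cast_succ, ← add_assoc, ← Finset.insert_Ico_right_eq_Ico_add_one (by omega),
        Finset.sum_insert Finset.right_notMem_Ico, ih]
      ring
  have htel' : ∑ r ∈ Finset.Ico s t, (g (r + 1) - g r) = g t - g s := by
    have := htel (t - s).toNat
    rwa [Int.toNat_of_nonneg (by omega), add_sub_cancel] at this
  have hsub : Finset.Ico s t ⊆ Finset.Ico lo hi := Finset.Ico_subset_Ico hs.1 ht.2.le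
  have hX1 : ∑ r ∈ Finset.Ico s t, X r ≤ B :=
    (Finset.sum_le_sum_of_subset_of_nonneg hsub fun r _ _ => hX r).trans hB
  have hX2 : ∑ r ∈ Finset.Ico s t, X (r + 1) ≤ B := by
    have himg : ∑ r ∈ Finset.Ico s t, X (r + 1) = ∑ r ∈ Finset.Ico (s + 1) (t + 1), X r := by
      rw [← Finset.image_add_right_Ico, Finset.sum_image fun _ _ _ _ h => add_right_cancel h]
    rw [himg]
    exact (Finset.sum_le_sum_of_subset_of_nonneg (Finset.Ico_subset_Ico (by omega) (by omega))
      fun r _ _ => hX r).trans hB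
  have hB0 : 0 ≤ B := (Finset.sum_nonneg fun r _ => hX r).trans hB
  calc (g s - g t) ^ 2 = (∑ r ∈ Finset.Ico s t, (g (r + 1) - g r)) ^ 2 := by
        rw [htel']
        ring
    _ ≤ (∑ r ∈ Finset.Ico s t, (X r + X (r + 1))) * ∑ r ∈ Finset.Ico s t, D r := by
        refine Finset.sum_sq_le_sum_mul_sum_of_sq_le_mul _ (fun r _ => add_nonneg (hX r) (hX _))
          (fun r _ => hD r) fun r hr => ?_
        rw [Finset.mem_Ico] at hr
        exact hstep r (by omega) (by omega)
    _ ≤ 2 * B * ∑ t ∈ Finset.Ico lo hi, D t := by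
        refine mul_le_mul ?_ (Finset.sum_le_sum_of_subset_of_nonneg hsub fun r _ _ => hD r)
          (Finset.sum_nonneg fun r _ => hD r) (by positivity)
        rw [Finset.sum_add_distrib]
        linarith

/-- The point with coordinates of `y` below `j` and of `x` from `j` on. -/
def mixPt (j : ℕ) (x y : Fin d → ℤ) : Fin d → ℤ := fun i => if (i : ℕ) < j then y i else x i

lemma mixPt_mem {lo hi x y : Fin d → ℤ} (hx : x ∈ latticeBox lo hi) (hy : y ∈ latticeBox lo hi)
    (j : ℕ) : mixPt j x y ∈ latticeBox lo hi := by
  rw [mem_latticeBox] at *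
  intro i
  unfold mixPt
  split_ifs
  · exact hy i
  · exact hx i

lemma mixPt_mixPt (j : ℕ) (x y : Fin d → ℤ) : mixPt j (mixPt j x y) (mixPt j y x) = x := by
  ext i
  by_cases h : (i : ℕ) < j <;> simp [mixPt, h]

lemma sq_sub_le_paths {F : (Fin d → ℤ) → ℝ} {X : (Fin d → ℤ) → ℝ}
    {D : (Fin d → ℤ) → Fin d → ℝ} {lo hi : Fin d → ℤ} {B : ℝ} (hX : ∀ u, 0 ≤ X u)
    (hD : ∀ u i, 0 ≤ D u i)
    (hstep : ∀ u ∈ latticeBox lo hi, ∀ i, Function.update u i (u i + 1) ∈ latticeBox lo hi →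
      (F (Function.update u i (u i + 1)) - F u) ^ 2
        ≤ (X u + X (Function.update u i (u i + 1))) * D u i)
    (hB : ∀ u ∈ latticeBox lo hi, ∀ i,
      ∑ t ∈ Finset.Ico (lo i) (hi i), X (Function.update u i t) ≤ B)
    {x y : Fin d → ℤ} (hx : x ∈ latticeBox lo hi) (hy : y ∈ latticeBox lo hi) :
    (F x - F y) ^ 2 ≤ d * (2 * B) * ∑ j : Fin d, ∑ t ∈ Finset.Ico (lo j) (hi j),
      D (Function.update (mixPt j x y) j t) j := by
  have htel : F x - F y = ∑ j : Fin d, (F (mixPt j x y) - F (mixPt (j + 1) x y)) := by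
    rw [Fin.sum_univ_eq_sum_range fun j => F (mixPt j x y) - F (mixPt (j + 1) x y),
      Finset.sum_range_sub']
    congr 2
    ext i
    simp [mixPt]
  have hcard := sq_sum_le_card_mul_sum_sq (s := (Finset.univ : Finset (Fin d)))
    (f := fun j => F (mixPt j x y) - F (mixPt (j + 1) x y))
  rw [← htel, Finset.card_univ, Fintype.card_fin] at hcard
  refine hcard.trans ?_
  rw [mul_assoc]
  refine mul_le_mul_of_nonneg_left ?_ (Nat.cast_nonneg d)
  rw [Finset.mul_sum]
  refine Finset.sum_le_sum fun j _ => ?_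
  have hp := mixPt_mem hx hy j
  have h1 : mixPt j x y = Function.update (mixPt j x y) j (x j) := by
    rw [eq_comm, Function.update_eq_self_iff]
    simp [mixPt]
  have h2 : mixPt (j + 1) x y = Function.update (mixPt j x y) j (y j) := by
    ext i
    by_cases hi : i = j
    · subst hi
      simp [mixPt]
    · have : (i : ℕ) ≠ j := fun h => hi (Fin.ext h)
      rw [Function.update_of_ne hi]
      simp only [mixPt]
      congr 1
      simp only [eq_iff_iff]
      omega
  rw [h2]
  nth_rewrite 1 [h1]
  rw [mem_latticeBox] at hx hy
  refine sq_sub_le_of_steps (g := fun t => F (Function.update (mixPt j x y) j t))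
    (X := fun t => X (Function.update (mixPt j x y) j t)) 
    (D := fun t => D (Function.update (mixPt j x y) j t) j) (fun _ => hX _) (fun _ => hD _ _)
    (fun t ht1 ht2 => ?_) (hB _ hp j) (Finset.mem_Ico.2 (hx j)) (Finset.mem_Ico.2 (hy j))
  have hm : Function.update (mixPt j x y) j t ∈ latticeBox lo hi :=
    update_mem_latticeBox hp (Finset.mem_Ico.2 ⟨ht1, by omega⟩)
  have hm' : Function.update (mixPt j x y) j (t + 1) ∈ latticeBox lo hi :=
    update_mem_latticeBox hp (Finset.mem_Ico.2 ⟨by omega, ht2⟩)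
  have := hstep _ hm j
  simp only [Function.update_self, Function.update_idem] at this
  exact this hm'

lemma sum_update_le_sum {D : (Fin d → ℤ) → ℝ} (hD : ∀ u, 0 ≤ D u) {lo hi u : Fin d → ℤ}
    (hu : u ∈ latticeBox lo hi) (j : Fin d) :
    ∑ t ∈ Finset.Ico (lo j) (hi j), D (Function.update u j t) ≤ ∑ p ∈ latticeBox lo hi, D p := by
  rw [← Finset.sum_image (f := D) (g := fun t => Function.update u j t)
    fun _ _ _ _ h => Function.update_injective u j h]
  refine Finset.sum_le_sum_of_subset_of_nonneg ?_ fun p _ _ => hD p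
  intro p hp
  obtain ⟨t, ht, rfl⟩ := Finset.mem_image.1 hp
  exact update_mem_latticeBox hu ht

lemma sum_sum_update (D : (Fin d → ℤ) → ℝ) (lo hi : Fin d → ℤ) (j : Fin d) :
    ∑ p ∈ latticeBox lo hi, ∑ t ∈ Finset.Ico (lo j) (hi j), D (Function.update p j t)
      = (Finset.Ico (lo j) (hi j)).card * ∑ p ∈ latticeBox lo hi, D p := by
  have hmul : ((Finset.Ico (lo j) (hi j)).card : ℝ) * ∑ p ∈ latticeBox lo hi, D p
      = ∑ q ∈ latticeBox lo hi ×ˢ Finset.Ico (lo j) (hi j), D q.1 := by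
    rw [Finset.sum_product, Finset.mul_sum]
    simp
  rw [← Finset.sum_product', hmul]
  have hmem : ∀ q ∈ latticeBox lo hi ×ˢ Finset.Ico (lo j) (hi j),
      (Function.update q.1 j q.2, q.1 j) ∈ latticeBox lo hi ×ˢ Finset.Ico (lo j) (hi j) := by
    intro q hq
    rw [Finset.mem_product] at hq ⊢
    exact ⟨update_mem_latticeBox hq.1 hq.2, Finset.mem_Ico.2 (mem_latticeBox.1 hq.1 j)⟩
  refine Finset.sum_nbij' (fun q => (Function.update q.1 j q.2, q.1 j))
    (fun q => (Function.update q.1 j q.2, q.1 j)) hmem hmem ?_ ?_ ?_ <;> simp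

lemma sum_sum_mixPt (D : (Fin d → ℤ) → ℝ) (lo hi : Fin d → ℤ) (j : ℕ) :
    ∑ x ∈ latticeBox lo hi, ∑ y ∈ latticeBox lo hi, D (mixPt j x y)
      = (latticeBox lo hi).card * ∑ p ∈ latticeBox lo hi, D p := by
  have hmul : ((latticeBox lo hi).card : ℝ) * ∑ p ∈ latticeBox lo hi, D p
      = ∑ q ∈ latticeBox lo hi ×ˢ latticeBox lo hi, D q.1 := by
    rw [Finset.sum_product, Finset.mul_sum]
    simp
  rw [← Finset.sum_product', hmul]
  have hmem : ∀ q ∈ latticeBox lo hi ×ˢ latticeBox lo hi,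
      (mixPt j q.1 q.2, mixPt j q.2 q.1) ∈ latticeBox lo hi ×ˢ latticeBox lo hi := by
    intro q hq
    rw [Finset.mem_product] at hq ⊢
    exact ⟨mixPt_mem hq.1 hq.2 j, mixPt_mem hq.2 hq.1 j⟩
  refine Finset.sum_nbij' (fun q => (mixPt j q.1 q.2, mixPt j q.2 q.1))
    (fun q => (mixPt j q.1 q.2, mixPt j q.2 q.1)) hmem hmem ?_ ?_ ?_ <;> simp [mixPt_mixPt]

lemma sum_sq_sub_le_paths {F : (Fin d → ℤ) → ℝ} {X : (Fin d → ℤ) → ℝ}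
    {D : (Fin d → ℤ) → Fin d → ℝ} {lo hi : Fin d → ℤ} {B : ℝ} {M : ℕ} (hX : ∀ u, 0 ≤ X u)
    (hD : ∀ u i, 0 ≤ D u i) (hB0 : 0 ≤ B) (hM : ∀ i, (Finset.Ico (lo i) (hi i)).card ≤ M)
    (hstep : ∀ u ∈ latticeBox lo hi, ∀ i, Function.update u i (u i + 1) ∈ latticeBox lo hi →
      (F (Function.update u i (u i + 1)) - F u) ^ 2
        ≤ (X u + X (Function.update u i (u i + 1))) * D u i)
    (hB : ∀ u ∈ latticeBox lo hi, ∀ i,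
      ∑ t ∈ Finset.Ico (lo i) (hi i), X (Function.update u i t) ≤ B) :
    ∑ x ∈ latticeBox lo hi, ∑ y ∈ latticeBox lo hi, (F x - F y) ^ 2
      ≤ d * (2 * B) * ((latticeBox lo hi).card * M * ∑ p ∈ latticeBox lo hi, ∑ j, D p j) := by
  refine (Finset.sum_le_sum fun x hx => Finset.sum_le_sum fun y hy =>
    sq_sub_le_paths hX hD hstep hB hx hy).trans ?_
  simp only [← Finset.mul_sum]
  refine mul_le_mul_of_nonneg_left ?_ (by positivity)
  have hcomm : ∑ x ∈ latticeBox lo hi, ∑ y ∈ latticeBox lo hi, ∑ j : Fin d,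
      ∑ t ∈ Finset.Ico (lo j) (hi j), D (Function.update (mixPt j x y) j t) j
      = ∑ j : Fin d, ∑ x ∈ latticeBox lo hi, ∑ y ∈ latticeBox lo hi,
      ∑ t ∈ Finset.Ico (lo j) (hi j), D (Function.update (mixPt j x y) j t) j := by
    rw [Finset.sum_comm (s := (Finset.univ : Finset (Fin d)))]
    exact Finset.sum_congr rfl fun x _ => Finset.sum_comm
  rw [hcomm, Finset.sum_comm (s := latticeBox lo hi), Finset.mul_sum]
  refine Finset.sum_le_sum fun j _ => ?_
  rw [sum_sum_mixPt fun p => ∑ t ∈ Finset.Ico (lo j) (hi j), D (Function.update p j t) j,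
    sum_sum_update fun p => D p j, ← mul_assoc]
  have : ((Finset.Ico (lo j) (hi j)).card : ℝ) ≤ M := by exact_mod_cast hM j
  have hs : 0 ≤ ∑ p ∈ latticeBox lo hi, D p j := Finset.sum_nonneg fun p _ => hD p j
  gcongr

lemma sq_sub_le_sum {F : (Fin d → ℤ) → ℝ} {D : (Fin d → ℤ) → Fin d → ℝ} {lo hi : Fin d → ℤ}
    {T : ℝ} {M : ℕ} (hT : 0 ≤ T) (hD : ∀ u i, 0 ≤ D u i)
    (hM : ∀ i, (Finset.Ico (lo i) (hi i)).card ≤ M)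
    (hstep : ∀ u ∈ latticeBox lo hi, ∀ i, Function.update u i (u i + 1) ∈ latticeBox lo hi →
      (F (Function.update u i (u i + 1)) - F u) ^ 2 ≤ (T + T) * D u i)
    {x y : Fin d → ℤ} (hx : x ∈ latticeBox lo hi) (hy : y ∈ latticeBox lo hi) :
    (F x - F y) ^ 2 ≤ d * (2 * (M * T)) * ∑ p ∈ latticeBox lo hi, ∑ j, D p j := by
  have hMT : ∀ u ∈ latticeBox lo hi, ∀ i : Fin d,
      ∑ t ∈ Finset.Ico (lo i) (hi i), (fun _ => T) (Function.update u i t) ≤ M * T := by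
    intro u _ i
    have : ((Finset.Ico (lo i) (hi i)).card : ℝ) ≤ M := by exact_mod_cast hM i
    rw [Finset.sum_const, nsmul_eq_mul]
    exact mul_le_mul_of_nonneg_right this hT
  refine (sq_sub_le_paths (X := fun _ => T) (fun _ => hT) hD hstep hMT hx hy).trans ?_
  refine mul_le_mul_of_nonneg_left ?_ (by positivity)
  rw [Finset.sum_comm (s := latticeBox lo hi)]
  exact Finset.sum_le_sum fun j _ =>
    sum_update_le_sum (D := fun p => D p j) (fun p => hD p j) (mixPt_mem hx hy j) j

/-! ### Lattice representatives and the energy comparison -/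

lemma dist_le_of_forall_abs_le {x y : Pt d} {a : ℝ} (h : ∀ i, |x i - y i| ≤ a) :
    dist x y ≤ d * a := by
  rcases Nat.eq_zero_or_pos d with rfl | hd
  · simp [EuclideanSpace.dist_eq]
  have ha : 0 ≤ a := (abs_nonneg _).trans (h ⟨0, hd⟩)
  rw [EuclideanSpace.dist_eq]
  refine Real.sqrt_le_iff.2 ⟨by positivity, ?_⟩
  have h1 : ∑ i, dist (x i) (y i) ^ 2 ≤ d * a ^ 2 := by
    refine (Finset.sum_le_sum fun i _ => pow_le_pow_left₀ dist_nonneg (h i) 2).trans_eq ?_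
    simp
  have h2 : (1 : ℝ) ≤ d := by exact_mod_cast hd
  nlinarith [sq_nonneg a]

/-- `g` maps each site `u` of the grid to a point of `E` in the box `v u`, at sup-distance at most
`r u` from `u`. -/
structure IsLatticeRep (K : ℝ) (E : Finset (Pt d)) (n : ℕ) (v : (Fin d → ℤ) → Fin d → ℤ)
    (r : (Fin d → ℤ) → ℕ) (g : (Fin d → ℤ) → Pt d) : Prop where
  mem : ∀ u ∈ grid d n, g u ∈ E
  mem_Kcube : ∀ u ∈ grid d n, g u ∈ Kcube d K (v u)
  near : ∀ u ∈ grid d n, ∀ i, |u i - v u i| ≤ r u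

lemma eq_of_mem_Kcube {K : ℝ} (hK : 0 < K) {p : Pt d} {x y : Fin d → ℤ} (hx : p ∈ Kcube d K x)
    (hy : p ∈ Kcube d K y) : x = y := by
  ext i
  have key : ∀ {a b : ℤ}, K * a ≤ p i → p i < K * b + K → a ≤ b := by
    intro a b ha hb
    have h : K * (a : ℝ) < K * ((b : ℝ) + 1) := by linarith
    have h' : (a : ℝ) < (b : ℝ) + 1 := lt_of_mul_lt_mul_left h hK.le
    have : a < b + 1 := by exact_mod_cast h'
    omega
  exact le_antisymm (key (hx i).1 (hy i).2) (key (hy i).1 (hx i).2)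

lemma sum_half_pow_le (S : Finset ℤ) (z : ℤ) :
    ∑ t ∈ S, ((1 : ℝ) / 2) ^ (t - z).natAbs ≤ 4 := by
  have key : ∀ S' : Finset ℤ, Set.InjOn (fun t : ℤ => (t - z).natAbs) S' →
      ∑ t ∈ S', ((1 : ℝ) / 2) ^ (t - z).natAbs ≤ 2 := by
    intro S' hinj
    rw [← Finset.sum_image (f := fun k : ℕ => ((1 : ℝ) / 2) ^ k) hinj]
    exact (summable_geometric_two.sum_le_tsum _ fun _ _ => by positivity).trans_eq
      tsum_geometric_two
  rw [← Finset.sum_filter_add_sum_filter_not S fun t => z ≤ t]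
  have h1 := key (S.filter fun t => z ≤ t) fun a ha b hb h => by
    simp only [Finset.coe_filter, Set.mem_ofPred_eq] at ha hb h
    omega
  have h2 := key (S.filter fun t => ¬ z ≤ t) fun a ha b hb h => by
    simp only [Finset.coe_filter, Set.mem_ofPred_eq] at ha hb h
    omega
  linarith

lemma sum_half_pow_near_le {n : ℕ} {S : Finset (Fin d → ℤ)} (hS : S ⊆ grid d n)
    (r : (Fin d → ℤ) → ℕ) (z : Fin d → ℤ) (h : ∀ u ∈ S, ∀ i, |u i - z i| ≤ r u) :
    ∑ u ∈ S, ((1 : ℝ) / 2) ^ (d * r u) ≤ 4 ^ d := by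
  calc ∑ u ∈ S, ((1 : ℝ) / 2) ^ (d * r u)
      ≤ ∑ u ∈ S, ∏ i, ((1 : ℝ) / 2) ^ (u i - z i).natAbs := by
        refine Finset.sum_le_sum fun u hu => ?_
        have : ((1 : ℝ) / 2) ^ (d * r u) = ∏ _i : Fin d, ((1 : ℝ) / 2) ^ r u := by
          simp [← pow_mul, mul_comm]
        rw [this]
        refine Finset.prod_le_prod (fun _ _ => by positivity) fun i _ => ?_
        refine pow_le_pow_of_le_one (by norm_num) (by norm_num) ?_
        have := h u hu i
        rw [Int.abs_eq_natAbs] at this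
        exact_mod_cast this
    _ ≤ ∑ u ∈ grid d n, ∏ i, ((1 : ℝ) / 2) ^ (u i - z i).natAbs :=
        Finset.sum_le_sum_of_subset_of_nonneg hS fun _ _ _ => by positivity
    _ = ∏ i, ∑ t ∈ Finset.Ico (-(n : ℤ)) n, ((1 : ℝ) / 2) ^ (t - z i).natAbs := by
        rw [grid, Finset.prod_univ_sum]
    _ ≤ ∏ _i : Fin d, (4 : ℝ) :=
        Finset.prod_le_prod (fun _ _ => by positivity) fun i _ => sum_half_pow_le _ _
    _ = 4 ^ d := by simp

/-- The square gradient of `f ∘ g` at `u` in direction `i`, in units of the cost of the step. -/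
def gradSq (α K : ℝ) (n : ℕ) (r : (Fin d → ℤ) → ℕ) (g : (Fin d → ℤ) → Pt d) (f : Pt d → ℝ)
    (u : Fin d → ℤ) (i : Fin d) : ℝ :=
  if u ∈ grid d n ∧ Function.update u i (u i + 1) ∈ grid d n then
    (f (g (Function.update u i (u i + 1))) - f (g u)) ^ 2 /
      stepCost α K d (max (r u) (r (Function.update u i (u i + 1))))
  else 0

lemma gradSq_nonneg (α K : ℝ) (n : ℕ) (r : (Fin d → ℤ) → ℕ) (g : (Fin d → ℤ) → Pt d)
    (f : Pt d → ℝ) (u : Fin d → ℤ) (i : Fin d) : 0 ≤ gradSq α K n r g f u i := by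
  unfold gradSq
  split_ifs
  · exact div_nonneg (sq_nonneg _) (stepCost_pos _ _ _ _).le
  · exact le_rfl

lemma sq_sub_le_mul_gradSq {α K : ℝ} {n : ℕ} {r : (Fin d → ℤ) → ℕ} {g : (Fin d → ℤ) → Pt d}
    {X : (Fin d → ℤ) → ℝ} (hX : ∀ u ∈ grid d n, stepCost α K d (r u) ≤ X u) (f : Pt d → ℝ)
    {u : Fin d → ℤ} {i : Fin d} (hu : u ∈ grid d n)
    (hu' : Function.update u i (u i + 1) ∈ grid d n) :
    (f (g (Function.update u i (u i + 1))) - f (g u)) ^ 2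
      ≤ (X u + X (Function.update u i (u i + 1))) * gradSq α K n r g f u i := by
  have hpos := stepCost_pos α K d (max (r u) (r (Function.update u i (u i + 1))))
  rw [gradSq, if_pos ⟨hu, hu'⟩, mul_div_assoc', le_div_iff₀ hpos, mul_comm]
  refine mul_le_mul_of_nonneg_right ?_ (sq_nonneg _)
  have h1 := hX _ hu
  have h2 := hX _ hu'
  have p1 := stepCost_pos α K d (r u)
  have p2 := stepCost_pos α K d (r (Function.update u i (u i + 1)))
  rcases max_choice (r u) (r (Function.update u i (u i + 1))) with h | h <;> rw [h] <;> linarith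

lemma IsLatticeRep.abs_sub_le {K : ℝ} (hK : 0 < K) {E : Finset (Pt d)} {n : ℕ}
    {v : (Fin d → ℤ) → Fin d → ℤ} {r : (Fin d → ℤ) → ℕ} {g : (Fin d → ℤ) → Pt d}
    (h : IsLatticeRep K E n v r g) {u : Fin d → ℤ} (hu : u ∈ grid d n) (i : Fin d) :
    K * u i - K * r u ≤ g u i ∧ g u i ≤ K * u i + K * r u + K := by
  have h1 := h.mem_Kcube u hu i
  have h2 : |(u i : ℝ) - v u i| ≤ r u := by exact_mod_cast h.near u hu i
  rw [abs_le] at h2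
  constructor <;> nlinarith [h1.1, h1.2]

lemma IsLatticeRep.gradSq_le {α K : ℝ} (hα : 0 ≤ α) (hK : 0 < K) {E : Finset (Pt d)} {n : ℕ}
    {v : (Fin d → ℤ) → Fin d → ℤ} {r : (Fin d → ℤ) → ℕ} {g : (Fin d → ℤ) → Pt d}
    (h : IsLatticeRep K E n v r g) (f : Pt d → ℝ) {u : Fin d → ℤ} (hu : u ∈ grid d n)
    (i : Fin d) :
    gradSq α K n r g f u i
      ≤ (1 / 2) ^ (d * r u) * ∑ y ∈ E, rate α (g u) y * (f (g u) - f y) ^ 2 := by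
  have hterm : ∀ y, 0 ≤ rate α (g u) y * (f (g u) - f y) ^ 2 := fun y =>
    mul_nonneg (rate_pos _ _ _).le (sq_nonneg _)
  rw [gradSq]
  split_ifs with hcond
  swap
  · exact mul_nonneg (by positivity) (Finset.sum_nonneg fun y _ => hterm y)
  obtain ⟨-, hu'⟩ := hcond
  set u' := Function.update u i (u i + 1) with hu'def
  set R := max (r u) (r u')
  have hr : (r u : ℝ) ≤ R := by exact_mod_cast le_max_left _ _
  have hr' : (r u' : ℝ) ≤ R := by exact_mod_cast le_max_right _ _
  have hdist : dist (g u) (g u') ≤ 2 * d * K * (1 + R) := by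
    have : ∀ l, |g u l - g u' l| ≤ 2 * K * (1 + R) := by
      intro l
      have h1 := h.abs_sub_le hK hu l
      have h2 := h.abs_sub_le hK hu' l
      have h3 : (u l : ℝ) ≤ u' l ∧ (u' l : ℝ) ≤ u l + 1 := by
        by_cases hl : l = i
        · subst hl
          simp [hu'def]
        · simp [hu'def, hl]
      have h4 := mul_le_mul_of_nonneg_left hr hK.le
      have h5 := mul_le_mul_of_nonneg_left hr' hK.le
      have h6 := mul_le_mul_of_nonneg_left h3.1 hK.le
      have h7 := mul_le_mul_of_nonneg_left h3.2 hK.le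
      rw [abs_le]
      constructor <;> nlinarith [h1.1, h1.2, h2.1, h2.2]
    linarith [dist_le_of_forall_abs_le this]
  have hcost : (stepCost α K d R)⁻¹ ≤ (1 / 2) ^ (d * r u) * rate α (g u) (g u') := by
    have h2 : ((1 : ℝ) / 2) ^ (d * r u) = Real.exp (-(d * r u * Real.log 2)) := by
      rw [one_div, inv_pow, Real.exp_neg]
      have := Real.exp_nat_mul (Real.log 2) (d * r u)
      push_cast at this
      rw [this, Real.exp_log two_pos]
    rw [stepCost, ← Real.exp_neg, h2, rate, ← Real.exp_add, Real.exp_le_exp]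
    have h3 := Real.rpow_le_rpow dist_nonneg hdist hα
    have h4 : (d : ℝ) * r u * Real.log 2 ≤ d * R * Real.log 2 := by
      have := Real.log_nonneg (one_le_two (α := ℝ))
      gcongr
    linarith
  calc (f (g u') - f (g u)) ^ 2 / stepCost α K d R
      = (stepCost α K d R)⁻¹ * (f (g u) - f (g u')) ^ 2 := by
        rw [div_eq_inv_mul, ← neg_sub, neg_sq]
    _ ≤ (1 / 2) ^ (d * r u) * (rate α (g u) (g u') * (f (g u) - f (g u')) ^ 2) := by
        rw [← mul_assoc]
        exact mul_le_mul_of_nonneg_right hcost (sq_nonneg _)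
    _ ≤ (1 / 2) ^ (d * r u) * ∑ y ∈ E, rate α (g u) y * (f (g u) - f y) ^ 2 :=
        mul_le_mul_of_nonneg_left (Finset.single_le_sum
          (f := fun y => rate α (g u) y * (f (g u) - f y) ^ 2) (fun y _ => hterm y)
          (h.mem u' hu')) (by positivity)

lemma IsLatticeRep.sum_gradSq_le {α K : ℝ} (hα : 0 ≤ α) (hK : 0 < K) {E : Finset (Pt d)} {n : ℕ}
    {v : (Fin d → ℤ) → Fin d → ℤ} {r : (Fin d → ℤ) → ℕ} {g : (Fin d → ℤ) → Pt d}
    (h : IsLatticeRep K E n v r g) (f : Pt d → ℝ) :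
    ∑ u ∈ grid d n, ∑ i, gradSq α K n r g f u i ≤ d * 4 ^ d * energy α E f := by
  set e : Pt d → ℝ := fun x => ∑ y ∈ E, rate α x y * (f x - f y) ^ 2 with he
  have he0 : ∀ x, 0 ≤ e x := fun x => Finset.sum_nonneg fun y _ =>
    mul_nonneg (rate_pos _ _ _).le (sq_nonneg _)
  have hsum : ∑ u ∈ grid d n, ((1 : ℝ) / 2) ^ (d * r u) * e (g u) ≤ 4 ^ d * energy α E f := by
    rw [← Finset.sum_fiberwise_of_maps_to h.mem, energy, Finset.mul_sum]
    refine Finset.sum_le_sum fun x _ => ?_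
    have hx : ∀ u ∈ (grid d n).filter fun u => g u = x,
        ((1 : ℝ) / 2) ^ (d * r u) * e (g u) = (1 / 2) ^ (d * r u) * e x := by
      intro u hu
      rw [(Finset.mem_filter.1 hu).2]
    rw [Finset.sum_congr rfl hx, ← Finset.sum_mul]
    refine mul_le_mul_of_nonneg_right ?_ (he0 x)
    rcases ((grid d n).filter fun u => g u = x).eq_empty_or_nonempty with hemp | ⟨u₀, hu₀⟩
    · rw [hemp]
      simp
    · refine sum_half_pow_near_le (n := n) (Finset.filter_subset _ _) r (v u₀) fun u hu i => ?_
      rw [Finset.mem_filter] at hu hu₀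
      have hv : v u = v u₀ := eq_of_mem_Kcube hK (h.mem_Kcube u hu.1)
        (by rw [hu.2, ← hu₀.2]; exact h.mem_Kcube u₀ hu₀.1)
      rw [← hv]
      exact h.near u hu.1 i
  calc ∑ u ∈ grid d n, ∑ i, gradSq α K n r g f u i
      ≤ ∑ u ∈ grid d n, ∑ _i : Fin d, ((1 : ℝ) / 2) ^ (d * r u) * e (g u) :=
        Finset.sum_le_sum fun u hu => Finset.sum_le_sum fun i _ => h.gradSq_le hα hK f hu i
    _ = d * ∑ u ∈ grid d n, ((1 : ℝ) / 2) ^ (d * r u) * e (g u) := by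
        simp [Finset.mul_sum]
    _ ≤ d * 4 ^ d * energy α E f := by
        rw [mul_assoc]
        exact mul_le_mul_of_nonneg_left hsum (Nat.cast_nonneg d)

/-! ### Variance bound by averaging over neighbourhoods in the grid -/

/-- The sites of the grid at sup-distance at most `s` from `u`. -/
def gridBall (n s : ℕ) (u : Fin d → ℤ) : Finset (Fin d → ℤ) :=
  latticeBox (fun i => max (-(n : ℤ)) (u i - s)) fun i => min n (u i + s + 1)

lemma mem_gridBall {n s : ℕ} {u p : Fin d → ℤ} :
    p ∈ gridBall n s u ↔ p ∈ grid d n ∧ ∀ i, |u i - p i| ≤ s := by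
  simp only [gridBall, mem_latticeBox, mem_grid, ← forall_and, abs_le]
  refine forall_congr' fun i => ?_
  omega

lemma gridBall_subset (n s : ℕ) (u : Fin d → ℤ) : gridBall n s u ⊆ grid d n := fun _ hp =>
  (mem_gridBall.1 hp).1

lemma le_card_gridBall {n s : ℕ} (hs : s + 1 ≤ 2 * n) {u : Fin d → ℤ} (hu : u ∈ grid d n) :
    (s + 1) ^ d ≤ (gridBall n s u).card := by
  rw [gridBall, latticeBox, Fintype.card_piFinset]
  have : ∏ _i : Fin d, (s + 1) = (s + 1) ^ d := by simp
  rw [← this]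
  refine Finset.prod_le_prod' fun i _ => ?_
  have := mem_grid.1 hu i
  rw [Int.card_Ico]
  omega

lemma sum_sum_gridBall_le {ι : Type*} {E : Finset ι} {n s : ℕ} {u : ι → Fin d → ℤ} {M : ℝ}
    (hM : ∀ q ∈ grid d n, ((E.filter fun x => ∀ i, |u x i - q i| ≤ s).card : ℝ) ≤ M)
    {φ : (Fin d → ℤ) → ℝ} (hφ : ∀ p, 0 ≤ φ p) :
    ∑ x ∈ E, ∑ p ∈ gridBall n s (u x), φ p ≤ M * ∑ p ∈ grid d n, φ p := by
  have h : ∀ x, gridBall n s (u x) = (grid d n).filter fun p => ∀ i, |u x i - p i| ≤ s := by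
    intro x
    ext p
    rw [mem_gridBall, Finset.mem_filter]
  simp only [h, Finset.sum_filter]
  rw [Finset.sum_comm, Finset.mul_sum]
  refine Finset.sum_le_sum fun p hp => ?_
  rw [← Finset.sum_filter, Finset.sum_const, nsmul_eq_mul]
  exact mul_le_mul_of_nonneg_right (hM p hp) (hφ p)

lemma exists_sum_sq_sub_le {ι : Type*} {G : Finset ι} (hG : G.Nonempty) {F : ι → ℝ} {a : ℝ}
    (h : ∑ p ∈ G, ∑ q ∈ G, (F p - F q) ^ 2 ≤ G.card * a) :
    ∃ m, ∑ p ∈ G, (F p - m) ^ 2 ≤ a := by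
  have hc : (0 : ℝ) < G.card := by exact_mod_cast hG.card_pos
  rw [Finset.sum_comm] at h
  have h' : ∑ q ∈ G, ∑ p ∈ G, (F p - F q) ^ 2 ≤ ∑ _q ∈ G, a := by
    simpa using h
  obtain ⟨q, -, hq⟩ := Finset.exists_le_of_sum_le hG h'
  exact ⟨F q, hq⟩

lemma sq_sub_le_average {ι : Type*} {S : Finset ι} {F : ι → ℝ} {y a m : ℝ} {k : ℝ} (hk : 0 < k)
    (hS : k ≤ S.card) (h : ∀ p ∈ S, (y - F p) ^ 2 ≤ a) :
    (y - m) ^ 2 ≤ 2 * a + 2 / k * ∑ p ∈ S, (F p - m) ^ 2 := by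
  have hc : (0 : ℝ) < S.card := hk.trans_le hS
  have h1 : ∑ _p ∈ S, (y - m) ^ 2 ≤ ∑ p ∈ S, (2 * a + 2 * (F p - m) ^ 2) := by
    refine Finset.sum_le_sum fun p hp => ?_
    nlinarith [h p hp, sq_nonneg ((y - F p) - (F p - m))]
  rw [Finset.sum_const, Finset.sum_add_distrib, Finset.sum_const, ← Finset.mul_sum, nsmul_eq_mul,
    nsmul_eq_mul] at h1
  have h0 : 0 ≤ ∑ p ∈ S, (F p - m) ^ 2 := Finset.sum_nonneg fun _ _ => sq_nonneg _
  have h2 : 2 / (S.card : ℝ) * ∑ p ∈ S, (F p - m) ^ 2 ≤ 2 / k * ∑ p ∈ S, (F p - m) ^ 2 := by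
    gcongr
  refine le_trans ?_ (add_le_add_right h2 (2 * a))
  rw [div_mul_eq_mul_div, ← sub_le_iff_le_add', le_div_iff₀ hc]
  linarith

lemma IsLatticeRep.exists_sum_sq_sub_le {α K : ℝ} (hα : 0 ≤ α) (hK : 0 < K) {E : Finset (Pt d)}
    {n : ℕ} (hn : 0 < n) {v : (Fin d → ℤ) → Fin d → ℤ} {r : (Fin d → ℤ) → ℕ}
    {g : (Fin d → ℤ) → Pt d} (h : IsLatticeRep K E n v r g) {X : (Fin d → ℤ) → ℝ}
    (hX0 : ∀ u, 0 ≤ X u) (hX : ∀ u ∈ grid d n, stepCost α K d (r u) ≤ X u) {A : ℝ} (hA : 0 ≤ A)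
    (hline : ∀ u ∈ grid d n, ∀ i,
      ∑ t ∈ Finset.Ico (-(n : ℤ)) n, X (Function.update u i t) ≤ A * (2 * n))
    {τ : ℝ} (hτ : ∀ u ∈ grid d n, stepCost α K d (r u) ≤ τ) {u₀ : Pt d → Fin d → ℤ}
    (hu₀ : ∀ x ∈ E, u₀ x ∈ grid d n) {κ : ℝ} (hκ : ∀ x ∈ E, 1 ≤ κ * rate α x (g (u₀ x)))
    {s : ℕ} (hs : s + 1 ≤ 2 * n) {M : ℝ}
    (hM : ∀ q ∈ grid d n, ((E.filter fun x => ∀ i, |u₀ x i - q i| ≤ s).card : ℝ) ≤ M)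
    (f : Pt d → ℝ) :
    ∃ m, ∑ x ∈ E, (f x - m) ^ 2 ≤ (4 * κ + (8 * d * (2 * s + 1) * τ * M
      + 2 / (s + 1) ^ d * M * (8 * d * A * n ^ 2)) * (d * 4 ^ d)) * energy α E f := by
  set D := gradSq α K n r g f with hD
  have hD0 : ∀ u i, 0 ≤ D u i := gradSq_nonneg α K n r g f
  set SD := ∑ p ∈ grid d n, ∑ i, D p i with hSD
  have hSD_le : SD ≤ d * 4 ^ d * energy α E f := h.sum_gradSq_le hα hK f
  have hzero : (0 : Fin d → ℤ) ∈ grid d n := mem_grid.2 fun i => by simp; omega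
  have hτ0 : 0 ≤ τ := (stepCost_pos _ _ _ _).le.trans (hτ 0 hzero)
  have hM0 : 0 ≤ M := (Nat.cast_nonneg _).trans (hM 0 hzero)
  set e : Pt d → ℝ := fun x => ∑ y ∈ E, rate α x y * (f x - f y) ^ 2 with he
  obtain ⟨m, hm⟩ : ∃ m, ∑ p ∈ grid d n, (f (g p) - m) ^ 2 ≤ 8 * d * A * n ^ 2 * SD := by
    refine _root_.exists_sum_sq_sub_le (F := fun p => f (g p)) ⟨0, hzero⟩ ?_
    have := sum_sq_sub_le_paths (F := fun u => f (g u)) (lo := fun _ => -(n : ℤ))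
      (hi := fun _ => (n : ℤ)) (M := 2 * n) (B := A * (2 * n)) hX0 hD0 (by positivity)
      (fun i => by rw [Int.card_Ico]; omega)
      (fun u hu i hu' => sq_sub_le_mul_gradSq hX f hu hu') hline
    refine this.trans_eq ?_
    simp only [hSD, grid, latticeBox]
    push_cast
    ring
  have hlocal : ∀ x ∈ E, ∀ p ∈ gridBall n s (u₀ x), (f x - f (g p)) ^ 2
      ≤ 2 * κ * e x + 4 * d * (2 * s + 1) * τ * ∑ q ∈ gridBall n s (u₀ x), ∑ i, D q i := by
    intro x hx p hp
    have hself : u₀ x ∈ gridBall n s (u₀ x) := mem_gridBall.2 ⟨hu₀ x hx, by simp⟩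
    have h1 : (f x - f (g (u₀ x))) ^ 2 ≤ κ * e x := by
      have h2 : rate α x (g (u₀ x)) * (f x - f (g (u₀ x))) ^ 2 ≤ e x :=
        Finset.single_le_sum (f := fun y => rate α x y * (f x - f y) ^ 2)
          (fun y _ => mul_nonneg (rate_pos _ _ _).le (sq_nonneg _)) (h.mem _ (hu₀ x hx))
      have hκ0 : 0 < κ := by
        have := hκ x hx
        have := rate_pos α x (g (u₀ x))
        by_contra hcon
        nlinarith
      calc (f x - f (g (u₀ x))) ^ 2
          ≤ κ * rate α x (g (u₀ x)) * (f x - f (g (u₀ x))) ^ 2 :=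
            le_mul_of_one_le_left (sq_nonneg _) (hκ x hx)
        _ ≤ κ * e x := by
            rw [mul_assoc]
            exact mul_le_mul_of_nonneg_left h2 hκ0.le
    have h3 := sq_sub_le_sum (F := fun u => f (g u)) (M := 2 * s + 1) hτ0 hD0
      (fun i => by rw [Int.card_Ico]; omega)
      (fun u hu i hu' => sq_sub_le_mul_gradSq (X := fun _ => τ) hτ f
        (gridBall_subset n s _ hu) (gridBall_subset n s _ hu')) hself hp
    push_cast at h3
    rw [← gridBall] at h3
    nlinarith [sq_nonneg ((f x - f (g (u₀ x))) - (f (g (u₀ x)) - f (g p)))]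
  have hpoint : ∀ x ∈ E, (f x - m) ^ 2 ≤ 2 * (2 * κ * e x + 4 * d * (2 * s + 1) * τ *
      ∑ q ∈ gridBall n s (u₀ x), ∑ i, D q i)
      + 2 / (s + 1) ^ d * ∑ p ∈ gridBall n s (u₀ x), (f (g p) - m) ^ 2 := by
    intro x hx
    refine sq_sub_le_average (F := fun p => f (g p)) (by positivity) ?_ (hlocal x hx)
    exact_mod_cast le_card_gridBall hs (hu₀ x hx)
  refine ⟨m, (Finset.sum_le_sum hpoint).trans ?_⟩
  have h1 := sum_sum_gridBall_le hM (φ := fun q => ∑ i, D q i)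
    fun q => Finset.sum_nonneg fun i _ => hD0 q i
  have h2 := sum_sum_gridBall_le hM (φ := fun p => (f (g p) - m) ^ 2) fun p => sq_nonneg _
  have hE : ∑ x ∈ E, e x = energy α E f := rfl
  simp only [Finset.sum_add_distrib, ← Finset.mul_sum, hE]
  rw [← hSD] at h1
  have hen := energy_nonneg α E f
  calc 2 * (2 * κ * energy α E f + 4 * d * (2 * s + 1) * τ *
        ∑ x ∈ E, ∑ q ∈ gridBall n s (u₀ x), ∑ i, D q i)
      + 2 / (s + 1) ^ d * ∑ x ∈ E, ∑ p ∈ gridBall n s (u₀ x), (f (g p) - m) ^ 2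
      ≤ 2 * (2 * κ * energy α E f + 4 * d * (2 * s + 1) * τ * (M * (d * 4 ^ d * energy α E f)))
      + 2 / (s + 1) ^ d * (M * (8 * d * A * n ^ 2 * (d * 4 ^ d * energy α E f))) := by
        gcongr
        · exact h1.trans (by gcongr)
        · exact h2.trans (mul_le_mul_of_nonneg_left (hm.trans (by gcongr)) hM0)
    _ = _ := by ring

/-! ### Geometry of the configuration -/

lemma GoodField.exists_latticeRep {ξ : Config d} {K : ℝ} (hK : 0 < K) {L : ℝ}
    {z : (Fin d → ℤ) → Bool} (hz : ∀ x, z x = true → (ξ ∩ Kcube d K x).Nonempty) {T : ℕ → ℝ}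
    (hT : ∀ m, 0 ≤ T m) {A : ℝ} {b N : ℕ} (hgood : GoodField T A b N z) (hb : 0 < b)
    (hbN : 2 * K * (b * N : ℕ) ≤ L) (hfin : (ξ ∩ cube d L).Finite) :
    ∃ v r g, IsLatticeRep K hfin.toFinset (b * N) v r g ∧
      ∀ u ∈ grid d (b * N), r u ≤ b ∧ T (r u) ≤ searchCost T b u z := by
  have hb' : (0 : ℤ) < b := by exact_mod_cast hb
  have key : ∀ u ∈ grid d (b * N), ∃ (v : Fin d → ℤ) (r : ℕ) (p : Pt d),
      p ∈ hfin.toFinset ∧ p ∈ Kcube d K v ∧ (∀ i, |u i - v i| ≤ r) ∧ r ≤ b ∧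
        T r ≤ searchCost T b u z := by
    intro u hu
    obtain ⟨v, r, hv, hvc, hnear, hr, hTr⟩ := exists_le_searchCost hT hb (hgood.2 u hu)
    obtain ⟨p, hp, hpK⟩ := hz v hv
    refine ⟨v, r, p, ?_, hpK, hnear, hr, hTr⟩
    rw [Set.Finite.mem_toFinset]
    refine ⟨hp, fun i => ?_⟩
    have h1 := mem_grid.1 hu i
    have h2 := (mem_cellSet_iff hb).1 hvc i
    have h3 : -(N : ℤ) ≤ u i / b := by
      rw [Int.le_ediv_iff_mul_le hb']
      have := h1.1
      push_cast at this
      linarith [mul_comm (b : ℤ) N]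
    have h4 : u i / b < (N : ℤ) := by
      rw [Int.ediv_lt_iff_lt_mul hb']
      have := h1.2
      push_cast at this
      linarith [mul_comm (b : ℤ) N]
    rw [← h2] at h3 h4
    rw [Int.le_ediv_iff_mul_le hb'] at h3
    rw [Int.ediv_lt_iff_lt_mul hb'] at h4
    have h5 : -((b * N : ℕ) : ℝ) ≤ v i := by
      have : -((b * N : ℕ) : ℤ) ≤ v i := by push_cast; linarith [mul_comm (b : ℤ) N]
      exact_mod_cast this
    have h6 : (v i : ℝ) + 1 ≤ (b * N : ℕ) := by
      have : v i + 1 ≤ ((b * N : ℕ) : ℤ) := by push_cast; linarith [mul_comm (b : ℤ) N]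
      exact_mod_cast this
    have h7 := hpK i
    rw [abs_le]
    constructor <;> nlinarith [h7.1, h7.2]
  choose! v r g h using key
  exact ⟨v, r, g, ⟨fun u hu => (h u hu).1, fun u hu => (h u hu).2.1, fun u hu => (h u hu).2.2.1⟩,
    fun u hu => (h u hu).2.2.2⟩

/-- The site of the grid closest to the box of side `K` containing `x`. -/
def clampSite (K : ℝ) (n : ℕ) (x : Pt d) : Fin d → ℤ := fun i =>
  max (-(n : ℤ)) (min (n - 1) ⌊x i / K⌋)

lemma clampSite_mem_grid {n : ℕ} (hn : 0 < n) (K : ℝ) (x : Pt d) :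
    clampSite K n x ∈ grid d n := by
  rw [mem_grid]
  intro i
  unfold clampSite
  omega

lemma abs_sub_clampSite_le {K : ℝ} (hK : 0 < K) {n b : ℕ} (hn : 0 < n) {x : Pt d}
    (hx : ∀ i, |x i| ≤ K * (n + b)) (i : Fin d) :
    |x i - K * clampSite K n x i| ≤ K * (b + 2) := by
  have h1 := hx i
  rw [abs_le] at h1
  have h2 : -((n : ℤ) + b) ≤ ⌊x i / K⌋ := by
    rw [Int.le_floor, le_div_iff₀ hK]
    push_cast
    linarith [h1.1]
  have h3 : ⌊x i / K⌋ ≤ (n : ℤ) + b := by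
    have : (⌊x i / K⌋ : ℝ) ≤ n + b := (Int.floor_le _).trans (by
      rw [div_le_iff₀ hK]
      linarith [h1.2])
    exact_mod_cast this
  have h4 : clampSite K n x i - (b + 1) ≤ ⌊x i / K⌋ ∧ ⌊x i / K⌋ ≤ clampSite K n x i + (b + 1) := by
    unfold clampSite
    omega
  have h5 : (clampSite K n x i : ℝ) - (b + 1) ≤ ⌊x i / K⌋ := by exact_mod_cast h4.1
  have h6 : (⌊x i / K⌋ : ℝ) ≤ clampSite K n x i + (b + 1) := by exact_mod_cast h4.2
  have h7 := Int.floor_le (x i / K)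
  have h8 := (Int.lt_floor_add_one (x i / K)).le
  have h9 : x i - K * clampSite K n x i = K * (x i / K - clampSite K n x i) := by field_simp
  rw [h9, abs_mul, abs_of_pos hK]
  refine mul_le_mul_of_nonneg_left ?_ hK.le
  rw [abs_le]
  constructor <;> linarith

lemma encard_le_Rfun {α : ℝ} (hα : 0 < α) (V : Set (Pt d)) (ξ : Config d) :
    ((ξ ∩ V).encard : ℝ≥0∞) ≤ Rfun α V ξ := by
  rw [← ENNReal.tsum_set_one, Rfun]
  refine ENNReal.tsum_le_tsum fun x => ?_
  refine le_trans ?_ (ENNReal.le_tsum (⟨x, x.2.1⟩ : ↥ξ))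
  simp [Real.zero_rpow hα.ne']

lemma card_filter_near_le {α : ℝ} (hα : 0 < α) {ξ : Config d} {L : ℕ} (hL : 0 < L) {ε Q : ℝ}
    (hQ : 0 ≤ Q)
    (hV : ∀ j : Fin d → ℤ, (Vcube d L ε j ∩ cube d L).Nonempty →
      Rfun α (Vcube d L ε j) ξ ≤ ENNReal.ofReal Q)
    (hfin : (ξ ∩ cube d L).Finite) {ρ : ℝ} (hρ : 0 ≤ ρ) (a : Fin d → ℝ) :
    ((hfin.toFinset.filter fun x => ∀ i, |x i - a i| ≤ ρ * (L : ℝ) ^ ε).card : ℝ)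
      ≤ (2 * ρ + 2) ^ d * Q := by
  have hw : 0 < (L : ℝ) ^ ε := by positivity
  set w := (L : ℝ) ^ ε with hwdef
  set J : Finset (Fin d → ℤ) :=
    Fintype.piFinset fun i => Finset.Icc ⌊a i / w - ρ⌋ ⌊a i / w + ρ⌋ with hJ
  have hmaps : ∀ x ∈ hfin.toFinset.filter fun x => ∀ i, |x i - a i| ≤ ρ * w,
      (fun i => ⌊x i / w⌋) ∈ J := by
    intro x hx
    rw [hJ, Fintype.mem_piFinset]
    intro i
    have := (Finset.mem_filter.1 hx).2 i
    rw [abs_le] at this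
    rw [Finset.mem_Icc]
    constructor
    · refine Int.floor_le_floor ?_
      rw [sub_le_iff_le_add, ← sub_le_iff_le_add', ← sub_div, div_le_iff₀ hw]
      linarith [this.1]
    · refine Int.floor_le_floor ?_
      rw [← sub_le_iff_le_add', ← sub_div, div_le_iff₀ hw]
      exact this.2
  have hJcard : (J.card : ℝ) ≤ (2 * ρ + 2) ^ d := by
    rw [hJ, Fintype.card_piFinset]
    push_cast
    refine (Finset.prod_le_prod (fun _ _ => by positivity) fun i _ => ?_).trans_eq
      (show ∏ _i : Fin d, (2 * ρ + 2) = (2 * ρ + 2) ^ d by simp)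
    have h1 : ⌊a i / w - ρ⌋ ≤ ⌊a i / w + ρ⌋ := Int.floor_le_floor (by linarith)
    rw [Int.card_Icc]
    have h2 : (((⌊a i / w + ρ⌋ + 1 - ⌊a i / w - ρ⌋).toNat : ℤ) : ℝ)
        = ((⌊a i / w + ρ⌋ + 1 - ⌊a i / w - ρ⌋ : ℤ) : ℝ) := by
      rw [Int.toNat_of_nonneg (by omega)]
    rw [← Int.cast_natCast, h2]
    push_cast
    linarith [Int.floor_le (a i / w + ρ), Int.lt_floor_add_one (a i / w - ρ)]
  rw [Finset.card_eq_sum_card_fiberwise hmaps]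
  push_cast
  have hfib : ∀ j ∈ J, (((hfin.toFinset.filter fun x => ∀ i, |x i - a i| ≤ ρ * w).filter
      fun x => (fun i => ⌊x i / w⌋) = j).card : ℝ) ≤ Q := by
    intro j _
    set S := (hfin.toFinset.filter fun x => ∀ i, |x i - a i| ≤ ρ * w).filter
      fun x => (fun i => ⌊x i / w⌋) = j with hS
    have hmem : ∀ x ∈ S, x ∈ ξ ∩ Vcube d L ε j ∧ x ∈ cube d L := by
      intro x hx
      rw [hS, Finset.mem_filter, Finset.mem_filter, Set.Finite.mem_toFinset] at hx
      refine ⟨⟨hx.1.1.1, fun i => ?_⟩, hx.1.1.2⟩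
      have h1 := congrFun hx.2 i
      simp only at h1
      rw [Int.floor_eq_iff, le_div_iff₀ hw, div_lt_iff₀ hw] at h1
      rw [← hwdef]
      constructor <;> linarith [h1.1, h1.2]
    rcases S.eq_empty_or_nonempty with h0 | ⟨x, hx⟩
    · rw [h0]
      simpa using hQ
    · have h1 : ((ξ ∩ Vcube d L ε j).encard : ℝ≥0∞) ≤ ENNReal.ofReal Q :=
        (encard_le_Rfun hα _ _).trans (hV j ⟨x, (hmem x hx).1.2, (hmem x hx).2⟩)
      have h2 : (S.card : ℕ∞) ≤ (ξ ∩ Vcube d L ε j).encard := by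
        rw [← Set.encard_coe_eq_coe_finsetCard]
        exact Set.encard_le_encard fun x hx => (hmem x hx).1
      have h3 : ((S.card : ℕ) : ℝ≥0∞) ≤ ENNReal.ofReal Q := by
        refine le_trans ?_ h1
        exact_mod_cast ENat.toENNReal_le.2 h2
      rwa [← ENNReal.ofReal_natCast, ENNReal.ofReal_le_ofReal_iff hQ] at h3
  refine (Finset.sum_le_sum hfib).trans ?_
  rw [Finset.sum_const, nsmul_eq_mul]
  exact mul_le_mul_of_nonneg_right hJcard hQ

/-! ### The Poincaré inequality -/

lemma IsLatticeRep.one_le_mul_rate {α K : ℝ} (hα : 0 ≤ α) (hK : 0 < K) {E : Finset (Pt d)}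
    {n b : ℕ} (hn : 0 < n) {v : (Fin d → ℤ) → Fin d → ℤ} {r : (Fin d → ℤ) → ℕ}
    {g : (Fin d → ℤ) → Pt d} (h : IsLatticeRep K E n v r g) (hr : ∀ u ∈ grid d n, r u ≤ b)
    {x : Pt d} (hx : ∀ i, |x i| ≤ K * (n + b)) {κ : ℝ}
    (hκ : Real.exp ((2 * d * K) ^ α * ((b : ℝ) + 2) ^ max α 1) ≤ κ) :
    1 ≤ κ * rate α x (g (clampSite K n x)) := by
  set u := clampSite K n x
  have hu : u ∈ grid d n := clampSite_mem_grid hn K x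
  have hru : (r u : ℝ) ≤ b := by exact_mod_cast hr u hu
  have hdist : dist x (g u) ≤ 2 * d * K * (b + 2) := by
    have : ∀ i, |x i - g u i| ≤ 2 * K * (b + 2) := by
      intro i
      have h1 := abs_sub_clampSite_le hK hn hx i
      have h2 := h.abs_sub_le hK hu i
      have h3 := mul_le_mul_of_nonneg_left hru hK.le
      rw [abs_le] at h1 ⊢
      constructor <;> linarith [h1.1, h1.2, h2.1, h2.2]
    exact (dist_le_of_forall_abs_le this).trans_eq (by ring)
  have hb : (0 : ℝ) ≤ b := Nat.cast_nonneg b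
  have h1 : dist x (g u) ^ α ≤ (2 * d * K) ^ α * ((b : ℝ) + 2) ^ max α 1 :=
    (Real.rpow_le_rpow dist_nonneg hdist hα).trans
      (mul_rpow_le_rpow_max hα (by positivity) (by positivity) le_rfl (by linarith))
  calc (1 : ℝ) = Real.exp (dist x (g u) ^ α) * rate α x (g u) := by
        rw [rate, ← Real.exp_add, add_neg_cancel, Real.exp_zero]
    _ ≤ κ * rate α x (g u) :=
        mul_le_mul_of_nonneg_right ((Real.exp_le_exp.2 h1).trans hκ) (rate_pos _ _ _).le

/-- The constant in the Poincaré inequality, as a function of the constants of the lattice field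
and of the density bound. -/
def poincareConst (d : ℕ) (K A M : ℝ) : ℝ :=
  4 + (40 * d * M + 4 * d * A * M / K ^ 2) * (d * 4 ^ d)

lemma poincare_coeff_le {d s n : ℕ} {K A M ℓ L : ℝ} (hK : 0 < K) (hA : 0 ≤ A) (hM : 0 ≤ M)
    (hℓ : 1 ≤ ℓ) (hL : 1 ≤ L) (hℓL : ℓ ^ (d + 1) = L) (hs1 : ℓ ≤ s + 1) (hs2 : (s : ℝ) ≤ 2 * ℓ)
    (hn : 2 * K * n ≤ L) :
    4 * L + (8 * d * (2 * s + 1) * L * (M * ℓ ^ d)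
      + 2 / (s + 1) ^ d * (M * ℓ ^ d) * (8 * d * A * n ^ 2)) * (d * 4 ^ d)
      ≤ poincareConst d K A M * L ^ 2 := by
  have h1 : 4 * L ≤ 4 * L ^ 2 := by nlinarith
  have h2 : 8 * d * (2 * s + 1) * L * (M * ℓ ^ d) ≤ 40 * d * M * L ^ 2 := by
    calc 8 * d * (2 * s + 1) * L * (M * ℓ ^ d)
        ≤ 8 * d * (5 * ℓ) * L * (M * ℓ ^ d) := by gcongr; linarith
      _ = 40 * d * M * ℓ ^ (d + 1) * L := by ring
      _ = 40 * d * M * L ^ 2 := by rw [hℓL]; ring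
  have h3 : 2 / ((s : ℝ) + 1) ^ d * (M * ℓ ^ d) ≤ 2 * M := by
    rw [div_mul_eq_mul_div, div_le_iff₀ (by positivity)]
    calc 2 * (M * ℓ ^ d) ≤ 2 * (M * (s + 1) ^ d) := by gcongr
      _ = 2 * M * (s + 1) ^ d := by ring
  have h4 : (n : ℝ) ^ 2 ≤ L ^ 2 / (4 * K ^ 2) := by
    rw [le_div_iff₀ (by positivity)]
    calc (n : ℝ) ^ 2 * (4 * K ^ 2) = (2 * K * n) ^ 2 := by ring
      _ ≤ L ^ 2 := by gcongr
  have h5 : 2 / ((s : ℝ) + 1) ^ d * (M * ℓ ^ d) * (8 * d * A * n ^ 2)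
      ≤ 4 * d * A * M / K ^ 2 * L ^ 2 := by
    calc 2 / ((s : ℝ) + 1) ^ d * (M * ℓ ^ d) * (8 * d * A * n ^ 2)
        ≤ 2 * M * (8 * d * A * (L ^ 2 / (4 * K ^ 2))) := by gcongr
      _ = 4 * d * A * M / K ^ 2 * L ^ 2 := by field_simp; ring
  calc 4 * L + (8 * d * (2 * s + 1) * L * (M * ℓ ^ d)
        + 2 / (s + 1) ^ d * (M * ℓ ^ d) * (8 * d * A * n ^ 2)) * (d * 4 ^ d)
      ≤ 4 * L ^ 2 + (40 * d * M * L ^ 2 + 4 * d * A * M / K ^ 2 * L ^ 2) * (d * 4 ^ d) := by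
        gcongr
    _ = poincareConst d K A M * L ^ 2 := by rw [poincareConst]; ring

lemma GoodField.exists_sum_sq_sub_le {α K : ℝ} (hα : 0 < α) (hK : 0 < K) {L : ℕ} (hL : 0 < L)
    {ξ : Config d} {z : (Fin d → ℤ) → Bool}
    (hz : ∀ x, z x = true → (ξ ∩ Kcube d K x).Nonempty) {A : ℝ} (hA : 0 ≤ A) {b N : ℕ}
    (hgood : GoodField (stepCost α K d) A b N z) (hb : 0 < b) (hN : 0 < N)
    (hbN : 2 * K * (b * N : ℕ) ≤ L) (hLbN : (L : ℝ) ≤ 2 * K * (b * (N + 1) : ℕ))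
    (hexp : Real.exp (((2 * d * K) ^ α + d) * ((b : ℝ) + 2) ^ max α 1) ≤ L) {ε : ℝ}
    (hεd : ε * (d + 1) = 1) (hbε : (b : ℝ) + 2 ≤ (L : ℝ) ^ ε)
    (hεL : 3 * (L : ℝ) ^ ε * (2 * K) ≤ L) {C : ℝ} (hC : 0 ≤ C)
    (hV : ∀ j : Fin d → ℤ, (Vcube d L ε j ∩ cube d L).Nonempty →
      Rfun α (Vcube d L ε j) ξ ≤ ENNReal.ofReal (C * (L : ℝ) ^ (ε * d)))
    (hfin : (ξ ∩ cube d L).Finite) (f : Pt d → ℝ) :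
    ∃ m, ∑ x ∈ hfin.toFinset, (f x - m) ^ 2
      ≤ poincareConst d K A ((6 * K + 2) ^ d * C) * (L : ℝ) ^ 2 * energy α hfin.toFinset f := by
  obtain ⟨v, r, g, hrep, hr⟩ := hgood.exists_latticeRep hK hz (fun m => (stepCost_pos α K d m).le)
    hb hbN hfin
  set ℓ := (L : ℝ) ^ ε with hℓ
  set n := b * N with hn
  have hn0 : 0 < n := Nat.mul_pos hb hN
  have hL1 : (1 : ℝ) ≤ L := by exact_mod_cast hL
  have hb0 : (0 : ℝ) ≤ b := Nat.cast_nonneg b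
  have hℓ1 : 1 ≤ ℓ := by linarith
  have hℓd : (L : ℝ) ^ (ε * d) = ℓ ^ d := by rw [Real.rpow_mul (by positivity), Real.rpow_natCast]
  have hℓL : ℓ ^ (d + 1) = L := by
    rw [hℓ, ← Real.rpow_natCast, ← Real.rpow_mul (by positivity)]
    push_cast
    rw [hεd, Real.rpow_one]
  have hs1 : ℓ ≤ ⌈ℓ⌉₊ := Nat.le_ceil ℓ
  have hs2 : (⌈ℓ⌉₊ : ℝ) < ℓ + 1 := Nat.ceil_lt_add_one (by positivity)
  set s := ⌈ℓ⌉₊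
  have hsn : s + 1 ≤ 2 * n := by
    have h1 : b * (N + 1) ≤ 2 * n := by nlinarith
    have h2 : ((b * (N + 1) : ℕ) : ℝ) ≤ (2 * n : ℕ) := by exact_mod_cast h1
    have h3 : 3 * ℓ ≤ (b * (N + 1) : ℕ) := by
      refine le_of_mul_le_mul_right ?_ (show 0 < 2 * K by positivity)
      linarith
    have h4 : ((s + 1 : ℕ) : ℝ) ≤ (2 * n : ℕ) := by
      push_cast at h2 h3 ⊢
      linarith
    exact_mod_cast h4
  have hxbd : ∀ x ∈ hfin.toFinset, ∀ i, |x i| ≤ K * (n + b) := by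
    intro x hx i
    have h1 := ((Set.Finite.mem_toFinset _).1 hx).2 i
    push_cast [hn] at hLbN ⊢
    linarith
  have hstep : ∀ u ∈ grid d n, stepCost α K d (r u) ≤ L := fun u hu =>
    (stepCost_mono hα.le hK.le d (hr u hu).1).trans ((stepCost_le hα.le hK.le d b).trans hexp)
  have hκ : Real.exp ((2 * d * K) ^ α * ((b : ℝ) + 2) ^ max α 1) ≤ L := by
    refine le_trans (Real.exp_le_exp.2 ?_) hexp
    gcongr
    linarith [(Nat.cast_nonneg d : (0 : ℝ) ≤ d)]
  have hM : ∀ q ∈ grid d n,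
      ((hfin.toFinset.filter fun x => ∀ i, |clampSite K n x i - q i| ≤ s).card : ℝ)
        ≤ (6 * K + 2) ^ d * C * ℓ ^ d := by
    intro q _
    have h1 := card_filter_near_le hα hL (Q := C * (L : ℝ) ^ (ε * d)) (by positivity) hV hfin
      (show 0 ≤ 3 * K by positivity) (fun i => K * q i)
    rw [hℓd] at h1
    have h2 : (hfin.toFinset.filter fun x => ∀ i, |clampSite K n x i - q i| ≤ s)
        ⊆ hfin.toFinset.filter fun x => ∀ i, |x i - K * q i| ≤ 3 * K * ℓ := by
      intro x hx
      rw [Finset.mem_filter] at hx ⊢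
      refine ⟨hx.1, fun i => ?_⟩
      have h3 := abs_sub_clampSite_le hK hn0 (hxbd x hx.1) i
      have h4 : |(clampSite K n x i : ℝ) - q i| ≤ s := by exact_mod_cast hx.2 i
      have h5 : |K * (clampSite K n x i : ℝ) - K * q i| ≤ K * s := by
        rw [← mul_sub, abs_mul, abs_of_pos hK]
        exact mul_le_mul_of_nonneg_left h4 hK.le
      have h6 := abs_sub_le (x i) (K * (clampSite K n x i : ℝ)) (K * q i)
      have h7 : K * (b + 2) + K * s ≤ 3 * K * ℓ := by nlinarith
      linarith
    have h3 : ((hfin.toFinset.filter fun x => ∀ i, |clampSite K n x i - q i| ≤ s).card : ℝ)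
        ≤ (hfin.toFinset.filter fun x => ∀ i, |x i - K * q i| ≤ 3 * K * ℓ).card := by
      exact_mod_cast Finset.card_le_card h2
    refine (h3.trans h1).trans_eq ?_
    ring
  obtain ⟨m, hm⟩ := hrep.exists_sum_sq_sub_le hα.le hK hn0
    (searchCost_nonneg (fun m => (stepCost_pos α K d m).le) b · z)
    (fun u hu => (hr u hu).2) hA hgood.1 hstep
    (fun x _ => clampSite_mem_grid hn0 K x)
    (fun x hx => hrep.one_le_mul_rate hα.le hK hn0 (fun u hu => (hr u hu).1) (hxbd x hx) hκ)
    hsn hM f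
  refine ⟨m, hm.trans (mul_le_mul_of_nonneg_right ?_ (energy_nonneg α _ f))⟩
  exact poincare_coeff_le hK hA (by positivity) hℓ1 hL1 hℓL (by linarith) (by linarith) hbN

lemma GoodField.nonempty {α K : ℝ} (hK : 0 < K) {L : ℕ} {ξ : Config d} {z : (Fin d → ℤ) → Bool}
    (hz : ∀ x, z x = true → (ξ ∩ Kcube d K x).Nonempty) {A : ℝ} {b N : ℕ}
    (hgood : GoodField (stepCost α K d) A b N z) (hb : 0 < b) (hN : 0 < N)
    (hbN : 2 * K * (b * N : ℕ) ≤ L) (hfin : (ξ ∩ cube d L).Finite) : hfin.toFinset.Nonempty := by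
  obtain ⟨v, r, g, hrep, -⟩ := hgood.exists_latticeRep hK hz (fun m => (stepCost_pos α K d m).le)
    hb hbN hfin
  exact ⟨_, hrep.mem 0 (mem_grid.2 fun i => by
    have := Nat.mul_pos hb hN
    simp only [Pi.zero_apply]
    omega)⟩

lemma ae_eventually_exists_sum_sq_sub_le (hd : 2 ≤ d) {α : ℝ} (hα : 0 < α) (hαd : α < d)
    {P : Measure (Config d)} (hA1 : AssumptionA1 P) (hA2 : AssumptionA2 α P) :
    ∃ C : ℝ, 0 < C ∧ ∀ᵐ ξ ∂P, ∀ᶠ L : ℕ in atTop, ∀ hfin : (ξ ∩ cube d L).Finite,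
      hfin.toFinset.Nonempty ∧ ∀ f : Pt d → ℝ, ∃ m, ∑ x ∈ hfin.toFinset, (f x - m) ^ 2
        ≤ C * (L : ℝ) ^ 2 * energy α hfin.toFinset f := by
  obtain ⟨K, hK, ν, hν, htransfer⟩ := hA1.exists_field one_half_pos one_half_lt_one
  obtain ⟨b, N, hb, hN, hbN, hLbN, hexp, hdecay⟩ := exists_scales hα hK hd hαd
  set A := stepCost α K d 0 + ∑' m : ℕ, stepCost α K d (m + 1) * (1 / 2) ^ (m + 1) ^ d + 1
  have hA : 0 ≤ A := add_nonneg (add_nonneg (stepCost_pos α K d 0).le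
    (tsum_nonneg fun m => mul_nonneg (stepCost_pos α K d (m + 1)).le (by positivity))) zero_le_one
  have hd0 : (0 : ℝ) < d := by exact_mod_cast (by omega : 0 < d)
  have hε0 : (0 : ℝ) < 1 / (d + 1) := by positivity
  have hε1 : (1 : ℝ) / (d + 1) < 1 := by
    rw [div_lt_one (by positivity)]
    linarith
  obtain ⟨C, hC, hdens⟩ := hA2 _ hε0 hε1
  refine ⟨poincareConst d K A ((6 * K + 2) ^ d * C), by rw [poincareConst]; positivity, ?_⟩
  filter_upwards [hdens, htransfer _ (hν.ae_eventually_goodField (stepCost_pos α K d)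
    (stepCost_mono hα.le hK.le d) (summable_stepCost hα hK.le hd hαd) hb hN hdecay)]
    with ξ hV ⟨z, hz, hgood⟩
  have hsmall := tendsto_natCast_atTop_atTop.eventually
    (eventually_mul_rpow_le_rpow (3 * (2 * K)) one_pos hε1)
  filter_upwards [hV, hgood, hb, hN, hLbN, hexp ((2 * d * K) ^ α + d) 1 (by positivity) one_pos,
    hexp 1 _ zero_le_one hε0, hsmall, eventually_gt_atTop 0]
    with L hV hgood hb hN hLbN hexp₁ hexp₂ hsmall hL hfin
  rw [Real.rpow_one] at hexp₁ hsmall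
  have hbε : (b L : ℝ) + 2 ≤ (L : ℝ) ^ ((1 : ℝ) / (d + 1)) := by
    have h0 : (0 : ℝ) ≤ b L := Nat.cast_nonneg _
    have h1 := le_rpow_max_one (α := α) (show 1 ≤ (b L : ℝ) + 2 by linarith)
    have h2 := Real.add_one_le_exp (1 * ((b L : ℝ) + 2) ^ max α 1)
    linarith
  exact ⟨hgood.nonempty hK hz hb hN (hbN L) hfin, hgood.exists_sum_sq_sub_le hα hK hL hz hA hb hN
    (hbN L) hLbN hexp₁ (by field_simp) hbε (by linarith) hC.le hV hfin⟩

lemma gammaP_one_le {α : ℝ} {E : Finset (Pt d)} (hE : E.Nonempty) {a : ℝ} (ha : 0 ≤ a)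
    (h : ∀ f : Pt d → ℝ, ∃ m, ∑ x ∈ E, (f x - m) ^ 2 ≤ a * energy α E f) :
    gammaP α E 1 ≤ ENNReal.ofReal (2 * a) := by
  have hc : (0 : ℝ) < E.card := by exact_mod_cast hE.card_pos
  refine iSup₂_le fun f _ => ENNReal.ofReal_le_ofReal ?_
  obtain ⟨m, hm⟩ := h f
  rw [dirichlet_one]
  refine div_le_of_le_mul₀ (div_nonneg (energy_nonneg α E f) (by positivity)) (by positivity) ?_
  calc varNu α E 1 f ≤ (E.card : ℝ)⁻¹ * ∑ x ∈ E, (f x - m) ^ 2 := varNu_one_le α hE f m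
    _ ≤ (E.card : ℝ)⁻¹ * (a * energy α E f) := by gcongr
    _ = 2 * a * (energy α E f / (2 * E.card)) := by field_simp

/-- Lemma 3.4: spectral profile bound and Poincaré inequality for model 1. -/
theorem stmt_11 (hd : 2 ≤ d) (α : ℝ) (hα0 : 0 < α) (hαd : α < d)
    (P : Measure (Config d)) (hP : IsPointProcess P)
    (hA1 : AssumptionA1 P) (hA2 : AssumptionA2 α P) :
    (∃ c : ℝ, 0 < c ∧ ∀ᵐ ξ ∂P, ∀ᶠ L : ℕ in atTop,
      ∀ hfin : (ξ ∩ cube d L).Finite,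
        ∀ r : ℝ, nuStar α hfin.toFinset 1 ≤ r → r < 1 →
          ENNReal.ofReal c * (hybridProfile α hfin.toFinset r) ^ 2 ≤
            ENNReal.ofReal (specProfile α hfin.toFinset 1 r)) ∧
    (∃ C : ℝ, 0 < C ∧ ∀ᵐ ξ ∂P, ∀ᶠ L : ℕ in atTop,
      ∀ hfin : (ξ ∩ cube d L).Finite,
        gammaP α hfin.toFinset 1 ≤ ENNReal.ofReal (C * (L : ℝ) ^ 2)) := by
  obtain ⟨C, hC, hae⟩ := ae_eventually_exists_sum_sq_sub_le hd hα0 hαd hA1 hA2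
  refine ⟨⟨1 / 2, one_half_pos, ?_⟩, 2 * C, by positivity, ?_⟩
  · filter_upwards [hae] with ξ hξ
    filter_upwards [hξ] with L hL hfin r hr hr1
    exact hybridProfile_sq_le_specProfile α (hL hfin).1 hr hr1
  · filter_upwards [hae] with ξ hξ
    filter_upwards [hξ] with L hL hfin
    rw [mul_assoc]
    exact gammaP_one_le (hL hfin).1 (by positivity) (hL hfin).2

end
end

section
/- Let d ≥ 1, a > 0, m ∈ ℕ with m ≥ 1, and let V = v + [0, ma)^d ⊂ ℝ^d be a cube partitioned into the m^d subcubes v + a·z + [0,a)^d, z ∈ {0,…,m−1}^d. Let ξ ⊂ ℝ^d be a finite set such that every subcube of the partition contains at least one point of ξ, and let U ⊆ ξ. If U ∩ V ≠ ∅ and (ξ∖U) ∩ V ≠ ∅, then there exist x ∈ U and y ∈ ξ∖U with |x − y| ≤ 2√d·a. -/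
noncomputable section

noncomputable instance {d : ℕ} : DecidableEq (EuclideanSpace ℝ (Fin d)) :=
  Classical.decEq _

/-- `GridCell v a z p` says that `p` lies in the half-open grid cell `v + a • z + [0, a)^d`. -/
def GridCell {d : ℕ} (v : EuclideanSpace ℝ (Fin d)) (a : ℝ) (z : Fin d → ℕ)
    (p : EuclideanSpace ℝ (Fin d)) : Prop :=
  ∀ i, v i + a * z i ≤ p i ∧ p i < v i + a * (z i + 1)

theorem dist_le_sqrt_mul_of_abs_sub_le {d : ℕ} {b : ℝ} (hb : 0 ≤ b)
    {p q : EuclideanSpace ℝ (Fin d)} (h : ∀ i, |p i - q i| ≤ b) :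
    dist p q ≤ Real.sqrt d * b := by
  rw [EuclideanSpace.dist_eq]
  apply Real.sqrt_le_iff.mpr
  refine ⟨by positivity, ?_⟩
  rw [mul_pow, Real.sq_sqrt (Nat.cast_nonneg d)]
  calc ∑ i, dist (p i) (q i) ^ 2 ≤ ∑ _i : Fin d, b ^ 2 := by
        gcongr with i
        simpa [Real.dist_eq] using h i
    _ = d * b ^ 2 := by simp

theorem GridCell.dist_le {d : ℕ} {v : EuclideanSpace ℝ (Fin d)} {a : ℝ} (ha : 0 < a)
    {z w : Fin d → ℕ} {p q : EuclideanSpace ℝ (Fin d)}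
    (hp : GridCell v a z p) (hq : GridCell v a w q)
    (hzw : ∀ i, z i ≤ w i + 1 ∧ w i ≤ z i + 1) :
    dist p q ≤ 2 * Real.sqrt d * a := by
  have h : dist p q ≤ Real.sqrt d * (2 * a) := by
    refine dist_le_sqrt_mul_of_abs_sub_le (by positivity) fun i => ?_
    obtain ⟨hp₁, hp₂⟩ := hp i
    obtain ⟨hq₁, hq₂⟩ := hq i
    have h₁ : (z i : ℝ) ≤ w i + 1 := mod_cast (hzw i).1
    have h₂ : (w i : ℝ) ≤ z i + 1 := mod_cast (hzw i).2
    have h₃ := mul_le_mul_of_nonneg_left h₁ ha.le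
    have h₄ := mul_le_mul_of_nonneg_left h₂ ha.le
    rw [abs_le]
    constructor <;> linarith
  linarith

theorem exists_gridCell {d : ℕ} {v : EuclideanSpace ℝ (Fin d)} {a : ℝ} (ha : 0 < a) {m : ℕ}
    {p : EuclideanSpace ℝ (Fin d)} (hp : ∀ i, v i ≤ p i ∧ p i < v i + m * a) :
    ∃ z : Fin d → ℕ, (∀ i, z i < m) ∧ GridCell v a z p := by
  have hnonneg : ∀ i, 0 ≤ (p i - v i) / a := fun i => div_nonneg (by linarith [(hp i).1]) ha.le
  refine ⟨fun i => ⌊(p i - v i) / a⌋₊, fun i => ?_, fun i => ⟨?_, ?_⟩⟩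
  · rw [Nat.floor_lt (hnonneg i), div_lt_iff₀ ha]
    linarith [(hp i).2]
  · have h := (le_div_iff₀ ha).mp (Nat.floor_le (hnonneg i))
    linarith
  · have h := (div_lt_iff₀ ha).mp (Nat.lt_floor_add_one ((p i - v i) / a))
    linarith

/-- The grid path from `z` to `w` moving each coordinate by at most one per step. -/
def gridPath {d : ℕ} (z w : Fin d → ℕ) (k : ℕ) (i : Fin d) : ℕ :=
  if z i ≤ w i then min (z i + k) (w i) else max (z i - k) (w i)

theorem gridPath_zero {d : ℕ} (z w : Fin d → ℕ) : gridPath z w 0 = z := by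
  funext i
  unfold gridPath
  split_ifs <;> omega

theorem gridPath_eq_right {d : ℕ} {z w : Fin d → ℕ} {m : ℕ} (hz : ∀ i, z i < m)
    (hw : ∀ i, w i < m) : gridPath z w m = w := by
  funext i
  have := hz i
  have := hw i
  unfold gridPath
  split_ifs <;> omega

theorem gridPath_lt {d : ℕ} {z w : Fin d → ℕ} {m : ℕ} (hz : ∀ i, z i < m)
    (hw : ∀ i, w i < m) (k : ℕ) (i : Fin d) : gridPath z w k i < m := by
  have := hz i
  have := hw i
  unfold gridPath
  split_ifs <;> omega

theorem gridPath_succ_adjacent {d : ℕ} (z w : Fin d → ℕ) (k : ℕ) (i : Fin d) :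
    gridPath z w k i ≤ gridPath z w (k + 1) i + 1 ∧
      gridPath z w (k + 1) i ≤ gridPath z w k i + 1 := by
  unfold gridPath
  split_ifs <;> omega

/-- Key geometric step in the proof of (2.15): if a cube `V = v + [0, ma)^d`,
partitioned into `m^d` subcubes of side `a` each containing a point of `ξ`,
meets both `U` and `ξ∖U`, then there are `x ∈ U`, `y ∈ ξ∖U` with `|x-y| ≤ 2√d·a`. -/
theorem stmt_12 {d : ℕ} (hd : 1 ≤ d) (a : ℝ) (ha : 0 < a) (m : ℕ) (hm : 1 ≤ m)
    (v : EuclideanSpace ℝ (Fin d)) (ξ U : Finset (EuclideanSpace ℝ (Fin d)))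
    (hU : U ⊆ ξ)
    (hfill : ∀ z : Fin d → ℕ, (∀ i, z i < m) →
      ∃ p ∈ ξ, ∀ i, v i + a * z i ≤ p i ∧ p i < v i + a * (z i + 1))
    (hUV : ∃ x ∈ U, ∀ i, v i ≤ x i ∧ x i < v i + m * a)
    (hUcV : ∃ y ∈ ξ \ U, ∀ i, v i ≤ y i ∧ y i < v i + m * a) :
    ∃ x ∈ U, ∃ y ∈ ξ \ U, dist x y ≤ 2 * Real.sqrt d * a := by
  obtain ⟨x, hx, hxV⟩ := hUV
  obtain ⟨y, hy, hyV⟩ := hUcV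
  obtain ⟨z, hz, hxz⟩ := exists_gridCell ha hxV
  obtain ⟨w, hw, hyw⟩ := exists_gridCell ha hyV
  by_contra! hfar
  have hmem : ∀ {p q}, p ∈ U → q ∈ ξ → dist p q ≤ 2 * Real.sqrt d * a → q ∈ U := by
    intro p q hp hq hpq
    by_contra hqU
    exact (hfar p hp q (Finset.mem_sdiff.mpr ⟨hq, hqU⟩)).not_ge hpq
  have hpath : ∀ k, ∀ q ∈ ξ, GridCell v a (gridPath z w k) q → q ∈ U := by
    intro k
    induction k with
    | zero =>
      intro q hq hqz
      rw [gridPath_zero] at hqz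
      exact hmem hx hq (hxz.dist_le ha hqz fun i => by omega)
    | succ k ih =>
      intro q hq hqz
      obtain ⟨p, hp, hpz⟩ := hfill (gridPath z w k) (gridPath_lt hz hw k)
      exact hmem (ih p hp hpz) hq
        (GridCell.dist_le ha hpz hqz (gridPath_succ_adjacent z w k))
  obtain ⟨hyξ, hyU⟩ := Finset.mem_sdiff.mp hy
  exact hyU (hpath m y hyξ (by rwa [gridPath_eq_right hz hw]))

end
end
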